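/- arXiv:1408.6981 — 8 statements merged into one kernel-verified Lean document; each statement's English description precedes it below -/
import Mathlib

section
/- Let ρ_1, …, ρ_N be density operators on ℂ^n ⊗ ℂ^m and let p_1, …, p_N be nonnegative reals summing to 1. Suppose H is a Hermitian operator on ℂ^n ⊗ ℂ^m such that H − p_k ρ_k is block positive for every k = 1, …, N. Then for every separable measurement {P_1, …, P_N} on ℂ^n : ℂ^m, the success probability satisfies Σ_{k=1}^N p_k Tr(ρ_k P_k) ≤ Tr(H). -/
open Matrix Complex
open scoped Matrix Kronecker ComplexOrder

noncomputable section

/-- The tensor (Kronecker) product of two vectors. -/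
def tens {α β : Type*} (u : α → ℂ) (v : β → ℂ) : α × β → ℂ := fun p => u p.1 * v p.2

/-- The rank-one operator `u u*`. -/
def proj {α : Type*} (u : α → ℂ) : Matrix α α ℂ := Matrix.vecMulVec u (star u)

/-- A separable (positive semidefinite) operator with respect to the bipartition `α : β`. -/
def SepMat {α β : Type*} [Fintype α] [Fintype β] (P : Matrix (α × β) (α × β) ℂ) : Prop :=
  ∃ (M : ℕ) (Q : Fin M → Matrix α α ℂ) (R : Fin M → Matrix β β ℂ),
    (∀ j, (Q j).PosSemidef) ∧ (∀ j, (R j).PosSemidef) ∧ P = ∑ j, Q j ⊗ₖ R j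

/-- The operator `(1 ⊗ y)* H (1 ⊗ y)` on the first factor. -/
def blockCompress {α β : Type*} [Fintype β] (H : Matrix (α × β) (α × β) ℂ) (y : β → ℂ) :
    Matrix α α ℂ :=
  Matrix.of fun i j => ∑ a, ∑ b, star (y a) * H (i, a) (j, b) * y b

/-- Block positivity with respect to the bipartition `α : β`. -/
def BlockPositive {α β : Type*} [Fintype α] [Fintype β] (H : Matrix (α × β) (α × β) ℂ) : Prop :=
  ∀ y : β → ℂ, (blockCompress H y).PosSemidef

/-- Partial transposition on the first tensor factor. -/
def ptFst {α β : Type*} (M : Matrix (α × β) (α × β) ℂ) : Matrix (α × β) (α × β) ℂ :=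
  Matrix.of fun r c => M (c.1, r.2) (r.1, c.2)

open scoped MatrixOrder in
theorem psd_factor {α : Type*} [Fintype α] {Q : Matrix α α ℂ} (hQ : Q.PosSemidef) :
    ∃ C : Matrix α α ℂ, Q = Cᴴ * C := by
  classical
  exact CStarAlgebra.nonneg_iff_eq_star_mul_self.mp hQ.nonneg

theorem trace_mul_psd_nonneg {α : Type*} [Fintype α] {X Q : Matrix α α ℂ}
    (hX : X.PosSemidef) (hQ : Q.PosSemidef) : 0 ≤ (X * Q).trace := by
  classical
  obtain ⟨C, rfl⟩ := psd_factor hQ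
  have h := (hX.mul_mul_conjTranspose_same C).trace_nonneg
  rwa [Matrix.mul_assoc, Matrix.trace_mul_comm, Matrix.mul_assoc] at h

theorem trace_mul_kron {α β : Type*} [Fintype α] [Fintype β]
    (A : Matrix (α × β) (α × β) ℂ) (Q : Matrix α α ℂ) (B : Matrix β β ℂ) :
    (A * (Q ⊗ₖ (Bᴴ * B))).trace
      = ∑ c, (blockCompress A (fun a => star (B c a)) * Q).trace := by
  simp only [Matrix.trace, Matrix.diag, Matrix.mul_apply, blockCompress, Matrix.of_apply,
    Fintype.sum_prod_type, Matrix.kroneckerMap_apply, Matrix.conjTranspose_apply,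
    Finset.mul_sum, Finset.sum_mul, star_star]
  rw [Finset.sum_comm' (t' := Finset.univ) (s' := fun _ => Finset.univ) (by simp)]
  have e1 : ∀ (F : β → α → α → β → β → ℂ),
      ∑ a, ∑ i, ∑ j, ∑ b, ∑ c, F a i j b c = ∑ c, ∑ i, ∑ j, ∑ a, ∑ b, F a i j b c := by
    intro F
    calc _ = ∑ a, ∑ i, ∑ j, ∑ c, ∑ b, F a i j b c := by
          refine Finset.sum_congr rfl fun a _ => Finset.sum_congr rfl fun i _ =>
            Finset.sum_congr rfl fun j _ => Finset.sum_comm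
      _ = ∑ a, ∑ i, ∑ c, ∑ j, ∑ b, F a i j b c := by
          refine Finset.sum_congr rfl fun a _ => Finset.sum_congr rfl fun i _ => Finset.sum_comm
      _ = ∑ a, ∑ c, ∑ i, ∑ j, ∑ b, F a i j b c := by
          refine Finset.sum_congr rfl fun a _ => Finset.sum_comm
      _ = ∑ c, ∑ a, ∑ i, ∑ j, ∑ b, F a i j b c := Finset.sum_comm
      _ = ∑ c, ∑ i, ∑ a, ∑ j, ∑ b, F a i j b c := by
          refine Finset.sum_congr rfl fun a _ => Finset.sum_comm
      _ = _ := by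
          refine Finset.sum_congr rfl fun a _ => Finset.sum_congr rfl fun i _ => Finset.sum_comm
  rw [e1]
  refine Finset.sum_congr rfl fun c _ => Finset.sum_congr rfl fun i _ =>
    Finset.sum_congr rfl fun j _ => Finset.sum_congr rfl fun a _ =>
    Finset.sum_congr rfl fun b _ => ?_
  ring

theorem trace_mul_sep_nonneg {α β : Type*} [Fintype α] [Fintype β]
    {A P : Matrix (α × β) (α × β) ℂ} (hA : BlockPositive A) (hP : SepMat P) :
    0 ≤ (A * P).trace := by
  classical
  obtain ⟨M, Q, R, hQ, hR, rfl⟩ := hP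
  rw [Matrix.mul_sum, Matrix.trace_sum]
  refine Finset.sum_nonneg fun j _ => ?_
  obtain ⟨B, hB⟩ := psd_factor (hR j)
  rw [hB, trace_mul_kron]
  exact Finset.sum_nonneg fun c _ => trace_mul_psd_nonneg (hA _) (hQ j)

/-- Every dual feasible `H` (i.e. `H − p_k ρ_k` block positive for all `k`) upper-bounds the
success probability of any separable measurement at discriminating the states `ρ_k` given with
prior probabilities `p_k`. -/
theorem sep_success_le_of_dual_feasible (n m N : ℕ)
    (ρ : Fin N → Matrix (Fin n × Fin m) (Fin n × Fin m) ℂ)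
    (hρpsd : ∀ k, (ρ k).PosSemidef) (hρtr : ∀ k, (ρ k).trace = 1)
    (p : Fin N → ℝ) (hp : ∀ k, 0 ≤ p k) (hpsum : ∑ k, p k = 1)
    (H : Matrix (Fin n × Fin m) (Fin n × Fin m) ℂ) (hH : H.IsHermitian)
    (hfeas : ∀ k, BlockPositive (H - (p k : ℂ) • ρ k))
    (P : Fin N → Matrix (Fin n × Fin m) (Fin n × Fin m) ℂ)
    (hsep : ∀ k, SepMat (P k)) (hsum : ∑ k, P k = 1) :
    ∑ k, p k * ((ρ k * P k).trace).re ≤ (H.trace).re := by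
  have h : H.trace = ∑ k, (H * P k).trace := by
    rw [← Matrix.trace_sum, ← Matrix.mul_sum, hsum, Matrix.mul_one]
  rw [h, Complex.re_sum]
  refine Finset.sum_le_sum fun k _ => ?_
  have h1 := (Complex.le_def.mp (trace_mul_sep_nonneg (hfeas k) (hsep k))).1
  rw [Matrix.sub_mul, Matrix.trace_sub, Matrix.smul_mul, Matrix.trace_smul, smul_eq_mul,
    Complex.sub_re, Complex.re_ofReal_mul, Complex.zero_re] at h1
  linarith
end
end

section
/- For every real t > 0, the linear map Ξ_t : L(ℂ² ⊕ ℂ²) → L(ℂ² ⊕ ℂ²) defined in 2×2-block form by Ξ_t([[A, B], [C, D]]) = [[Ψ_t(D) + Φ(D), Ψ_t(B) + Φ(C)], [Ψ_t(C) + Φ(B), Ψ_t(A) + Φ(A)]] is a positive map: it sends every positive semidefinite 4×4 matrix to a positive semidefinite 4×4 matrix. -/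
open Matrix Complex
open scoped Matrix ComplexOrder

noncomputable section

/-- The map `Ψ_t` on 2×2 matrices: `[[α, β], [γ, δ]] ↦ [[tα, β], [γ, t⁻¹δ]]`. -/
def psiMap (t : ℝ) (M : Matrix (Fin 2) (Fin 2) ℂ) : Matrix (Fin 2) (Fin 2) ℂ :=
  !![(t : ℂ) * M 0 0, M 0 1; M 1 0, (t : ℂ)⁻¹ * M 1 1]

/-- The map `Φ` on 2×2 matrices: `[[α, β], [γ, δ]] ↦ [[δ, −β], [−γ, α]]`. -/
def phiMap (M : Matrix (Fin 2) (Fin 2) ℂ) : Matrix (Fin 2) (Fin 2) ℂ :=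
  !![M 1 1, -(M 0 1); -(M 1 0), M 0 0]

/-- The map `Ξ_t` on `L(ℂ² ⊕ ℂ²)`, in 2×2 block form
`[[A, B], [C, D]] ↦ [[Ψ_t(D) + Φ(D), Ψ_t(B) + Φ(C)], [Ψ_t(C) + Φ(B), Ψ_t(A) + Φ(A)]]`. -/
def xiMap (t : ℝ) (M : Matrix (Fin 2 ⊕ Fin 2) (Fin 2 ⊕ Fin 2) ℂ) :
    Matrix (Fin 2 ⊕ Fin 2) (Fin 2 ⊕ Fin 2) ℂ :=
  Matrix.fromBlocks
    (psiMap t M.toBlocks₂₂ + phiMap M.toBlocks₂₂)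
    (psiMap t M.toBlocks₁₂ + phiMap M.toBlocks₂₁)
    (psiMap t M.toBlocks₂₁ + phiMap M.toBlocks₁₂)
    (psiMap t M.toBlocks₁₁ + phiMap M.toBlocks₁₁)

theorem xiMap_add (t : ℝ) (M N : Matrix (Fin 2 ⊕ Fin 2) (Fin 2 ⊕ Fin 2) ℂ) :
    xiMap t (M + N) = xiMap t M + xiMap t N := by
  ext i j
  rcases i with i | i <;> rcases j with j | j <;> fin_cases i <;> fin_cases j <;>
    simp [xiMap, psiMap, phiMap, toBlocks₁₁, toBlocks₁₂, toBlocks₂₁, toBlocks₂₂] <;> ring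

theorem xiMap_zero (t : ℝ) : xiMap t 0 = 0 := by
  ext i j
  rcases i with i | i <;> rcases j with j | j <;> fin_cases i <;> fin_cases j <;>
    simp [xiMap, psiMap, phiMap, toBlocks₁₁, toBlocks₁₂, toBlocks₂₁, toBlocks₂₂]

theorem xiMap_sum (t : ℝ) {ι : Type*} (s : Finset ι)
    (f : ι → Matrix (Fin 2 ⊕ Fin 2) (Fin 2 ⊕ Fin 2) ℂ) :
    xiMap t (∑ i ∈ s, f i) = ∑ i ∈ s, xiMap t (f i) := by
  classical
  induction s using Finset.induction_on with
  | empty => simp [xiMap_zero]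
  | insert a s ha ih => rw [Finset.sum_insert ha, Finset.sum_insert ha, xiMap_add, ih]

/-- The weight `t |a|² + |b|²`. -/
def wgt (t : ℝ) (a b : ℂ) : ℝ := t * normSq a + normSq b

theorem wgt_cast (t : ℝ) (a b : ℂ) :
    (wgt t a b : ℂ) = t * (a * star a) + b * star b := by
  simp [wgt, Complex.mul_conj]

/-- The off-diagonal block. -/
def offB (t : ℝ) (a b c d : ℂ) : Matrix (Fin 2) (Fin 2) ℂ :=
  !![t * (a * star c) + d * star b, a * star d - c * star b;
     b * star c - d * star a, (t : ℂ)⁻¹ * (b * star d) + c * star a]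

/-- Diagonal blocks. -/
def diagB (t p : ℝ) : Matrix (Fin 2) (Fin 2) ℂ := diagonal ![(p : ℂ), ((t⁻¹ * p : ℝ) : ℂ)]

theorem xiMap_rankOne_eq (t : ℝ) (ht : 0 < t) (x : Fin 2 ⊕ Fin 2 → ℂ) :
    xiMap t (vecMulVec x (star x)) =
      fromBlocks (diagB t (wgt t (x (.inr 0)) (x (.inr 1))))
        (offB t (x (.inl 0)) (x (.inl 1)) (x (.inr 0)) (x (.inr 1)))
        (offB t (x (.inl 0)) (x (.inl 1)) (x (.inr 0)) (x (.inr 1)))ᴴ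
        (diagB t (wgt t (x (.inl 0)) (x (.inl 1)))) := by
  have htc : (t : ℂ) ≠ 0 := by exact_mod_cast ht.ne'
  ext i j
  rcases i with i | i <;> rcases j with j | j <;> fin_cases i <;> fin_cases j <;>
    simp [xiMap, psiMap, phiMap, toBlocks₁₁, toBlocks₁₂, toBlocks₂₁, toBlocks₂₂, offB, diagB,
      wgt_cast, vecMulVec_apply] <;> field_simp <;> ring

theorem diagB_psd (t p : ℝ) (ht : 0 < t) (hp : 0 ≤ p) : (diagB t p).PosSemidef := by
  refine PosSemidef.diagonal ?_
  intro i
  have h : (0 : ℝ) ≤ t⁻¹ * p := by positivity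
  fin_cases i
  · simpa using hp
  · show (0 : ℂ) ≤ ((t⁻¹ * p : ℝ) : ℂ)
    exact_mod_cast h

theorem diagB_pd (t p : ℝ) (ht : 0 < t) (hp : 0 < p) : (diagB t p).PosDef := by
  refine PosDef.diagonal ?_
  intro i
  have h : (0 : ℝ) < t⁻¹ * p := by positivity
  fin_cases i
  · simpa using hp
  · show (0 : ℂ) < ((t⁻¹ * p : ℝ) : ℂ)
    exact_mod_cast h

theorem diagB_inv (t p : ℝ) (ht : 0 < t) (hp : 0 < p) :
    (diagB t p)⁻¹ = diagonal ![(p : ℂ)⁻¹, t * (p : ℂ)⁻¹] := by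
  have htc : (t : ℂ) ≠ 0 := by exact_mod_cast ht.ne'
  have hpc : (p : ℂ) ≠ 0 := by exact_mod_cast hp.ne'
  apply inv_eq_right_inv
  ext i j
  fin_cases i <;> fin_cases j <;> simp [diagB, hpc] <;> field_simp

theorem schur_zero (t : ℝ) (ht : 0 < t) (a b c d : ℂ) (hp : 0 < wgt t c d) :
    diagB t (wgt t a b) - (offB t a b c d)ᴴ * (diagB t (wgt t c d))⁻¹ * offB t a b c d = 0 := by
  have htc : (t : ℂ) ≠ 0 := by exact_mod_cast ht.ne'
  have hpc : (wgt t c d : ℂ) ≠ 0 := by exact_mod_cast hp.ne'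
  rw [diagB_inv t _ ht hp]
  ext i j
  fin_cases i <;> fin_cases j <;>
    simp [diagB, offB, Matrix.mul_apply, Fin.sum_univ_two, diagonal_apply] <;>
    field_simp <;> simp only [wgt_cast] <;> simp <;> ring

theorem wgt_nonneg (t : ℝ) (ht : 0 < t) (a b : ℂ) : 0 ≤ wgt t a b :=
  add_nonneg (mul_nonneg ht.le (normSq_nonneg a)) (normSq_nonneg b)

theorem block_psd (t : ℝ) (ht : 0 < t) (a b c d : ℂ) :
    (fromBlocks (diagB t (wgt t c d)) (offB t a b c d) (offB t a b c d)ᴴ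
      (diagB t (wgt t a b))).PosSemidef := by
  rcases (wgt_nonneg t ht c d).lt_or_eq with hp | hp
  · have hA := diagB_pd t _ ht hp
    haveI := hA.isUnit.invertible
    rw [PosDef.fromBlocks₁₁ _ _ hA, schur_zero t ht a b c d hp]
    exact PosSemidef.zero
  · have h1 : 0 ≤ t * normSq c := mul_nonneg ht.le (normSq_nonneg c)
    have h2 := normSq_nonneg d
    have hd : d = 0 := by
      rw [← normSq_eq_zero]
      unfold wgt at hp
      linarith
    have hc : c = 0 := by
      rw [← normSq_eq_zero]
      unfold wgt at hp
      have h3 : t * normSq c = 0 := by linarith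
      exact (mul_eq_zero.mp h3).resolve_left ht.ne'
    subst hd hc
    have hr := wgt_nonneg t ht a b
    have hr2 : (0 : ℝ) ≤ t⁻¹ * wgt t a b := by positivity
    have e : fromBlocks (diagB t (wgt t 0 0)) (offB t a b 0 0) (offB t a b 0 0)ᴴ
        (diagB t (wgt t a b)) =
        diagonal (Sum.elim 0 ![((wgt t a b : ℝ) : ℂ), ((t⁻¹ * wgt t a b : ℝ) : ℂ)]) := by
      ext i j
      rcases i with i | i <;> rcases j with j | j <;> fin_cases i <;> fin_cases j <;>
        simp [offB, diagB, wgt]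
    rw [e]
    refine PosSemidef.diagonal ?_
    rintro (i | i)
    · simp
    · fin_cases i
      · show (0 : ℂ) ≤ ((wgt t a b : ℝ) : ℂ)
        exact_mod_cast hr
      · show (0 : ℂ) ≤ ((t⁻¹ * wgt t a b : ℝ) : ℂ)
        exact_mod_cast hr2

/-- For every `t > 0`, the map `Ξ_t` is positive: it sends positive semidefinite matrices to
positive semidefinite matrices. -/
theorem xiMap_positive (t : ℝ) (ht : 0 < t)
    (M : Matrix (Fin 2 ⊕ Fin 2) (Fin 2 ⊕ Fin 2) ℂ) (hM : M.PosSemidef) :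
    (xiMap t M).PosSemidef := by
  obtain ⟨N, rfl⟩ : ∃ N : Matrix (Fin 2 ⊕ Fin 2) (Fin 2 ⊕ Fin 2) ℂ, M = star N * N := by
    open scoped MatrixOrder Matrix.Norms.L2Operator in
    exact CStarAlgebra.nonneg_iff_eq_star_mul_self.mp hM.nonneg
  have e : star N * N = ∑ k, vecMulVec (fun i => star (N k i)) (star fun i => star (N k i)) := by
    ext i j
    simp [Matrix.mul_apply, Matrix.sum_apply, vecMulVec_apply, star_eq_conjTranspose]
  rw [e, xiMap_sum]
  refine posSemidef_sum _ fun k _ => ?_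
  rw [xiMap_rankOne_eq t ht]
  exact block_psd t ht _ _ _ _
end
end

section
/- Let X₁ = X₂ = Y₁ = Y₂ = ℂ² and let ε ∈ [0,1]. For any separable measurement {P₁, P₂, P₃} on (X₁⊗X₂) : (Y₁⊗Y₂), the success probability of discriminating the three states φ_k ⊗ τ_ε (k = 1, 2, 3) with uniform prior 1/3 satisfies (1/3) Σ_{k=1}^{3} ⟨φ_k ⊗ τ_ε, W P_k W*⟩ ≤ (2 + √(1 − ε²))/3. -/
open Matrix Complex
open scoped Matrix Kronecker ComplexOrder

noncomputable section

/-- The four Bell states on two qubits. -/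
def bellVec : Fin 4 → (Fin 2 × Fin 2) → ℂ :=
  ![fun p => if p.1 = p.2 then ((Real.sqrt 2 : ℂ))⁻¹ else 0,
    fun p => if p = (0, 0) then ((Real.sqrt 2 : ℂ))⁻¹
             else if p = (1, 1) then -((Real.sqrt 2 : ℂ))⁻¹ else 0,
    fun p => if p.1 ≠ p.2 then ((Real.sqrt 2 : ℂ))⁻¹ else 0,
    fun p => if p = (0, 1) then ((Real.sqrt 2 : ℂ))⁻¹
             else if p = (1, 0) then -((Real.sqrt 2 : ℂ))⁻¹ else 0]

/-- The ancillary resource state `|τ_ε⟩ = √((1+ε)/2)|00⟩ + √((1−ε)/2)|11⟩`. -/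
def tauVec (ε : ℝ) : (Fin 2 × Fin 2) → ℂ :=
  fun p => if p = (0, 0) then (Real.sqrt ((1 + ε) / 2) : ℂ)
           else if p = (1, 1) then (Real.sqrt ((1 - ε) / 2) : ℂ) else 0

/-- Conjugation by the swap unitary `W` exchanging the two middle tensor factors:
if `M` is indexed with grouping `((a₁, a₂), (b₁, b₂))`, the result is indexed with
grouping `((a₁, b₁), (a₂, b₂))`. -/
def regroup {α₁ α₂ β₁ β₂ : Type*}
    (M : Matrix ((α₁ × α₂) × (β₁ × β₂)) ((α₁ × α₂) × (β₁ × β₂)) ℂ) :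
    Matrix ((α₁ × β₁) × (α₂ × β₂)) ((α₁ × β₁) × (α₂ × β₂)) ℂ :=
  Matrix.of fun r c =>
    M ((r.1.1, r.2.1), (r.1.2, r.2.2)) ((c.1.1, c.2.1), (c.1.2, c.2.2))

/-- The sesquilinear functional given by two vectors on the regrouped operator. -/
def betaForm (z z' : (Fin 2 × Fin 2) × (Fin 2 × Fin 2) → ℂ) :
    Matrix ((Fin 2 × Fin 2) × (Fin 2 × Fin 2)) ((Fin 2 × Fin 2) × (Fin 2 × Fin 2)) ℂ →ₗ[ℂ] ℂ where
  toFun P := star z ⬝ᵥ (regroup P *ᵥ z')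
  map_add' P Q := by
    have : regroup (P + Q) = regroup P + regroup Q := by ext; simp [regroup]
    rw [this, Matrix.add_mulVec, dotProduct_add]
  map_smul' c P := by
    have : regroup (c • P) = c • regroup P := by ext; simp [regroup]
    rw [this, Matrix.smul_mulVec, dotProduct_smul]; simp

/-- Product vector regrouped. -/
def wVec (a b : Fin 2 × Fin 2 → ℂ) : (Fin 2 × Fin 2) × (Fin 2 × Fin 2) → ℂ :=
  fun r => a (r.1.1, r.2.1) * b (r.1.2, r.2.2)

/-- Amplitude. -/
def amp (a b : Fin 2 × Fin 2 → ℂ) (z : (Fin 2 × Fin 2) × (Fin 2 × Fin 2) → ℂ) : ℂ :=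
  star z ⬝ᵥ wVec a b

lemma regroup_proj (a b : Fin 2 × Fin 2 → ℂ) :
    regroup (proj a ⊗ₖ proj b) = proj (wVec a b) := by
  ext i j
  simp [regroup, proj, wVec, Matrix.vecMulVec_apply, Matrix.kroneckerMap_apply]
  ring

lemma betaForm_proj (z z' : (Fin 2 × Fin 2) × (Fin 2 × Fin 2) → ℂ) (a b : Fin 2 × Fin 2 → ℂ) :
    betaForm z z' (proj a ⊗ₖ proj b) = amp a b z * star (amp a b z') := by
  change star z ⬝ᵥ (regroup (proj a ⊗ₖ proj b) *ᵥ z') = _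
  rw [regroup_proj, proj, Matrix.vecMulVec_mulVec]
  have h : star (amp a b z') = star (wVec a b) ⬝ᵥ z' := by
    rw [amp, Matrix.star_dotProduct, star_star]
  rw [h, amp]
  simp [mul_comm]

lemma betaForm_one (φ τ φ' τ' : Fin 2 × Fin 2 → ℂ) :
    betaForm (tens φ τ) (tens φ' τ') 1 = (star φ ⬝ᵥ φ') * (star τ ⬝ᵥ τ') := by
  change star (tens φ τ) ⬝ᵥ (regroup (1 : Matrix ((Fin 2 × Fin 2) × (Fin 2 × Fin 2))
      ((Fin 2 × Fin 2) × (Fin 2 × Fin 2)) ℂ) *ᵥ (tens φ' τ')) = _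
  have : regroup (1 : Matrix ((Fin 2 × Fin 2) × (Fin 2 × Fin 2))
      ((Fin 2 × Fin 2) × (Fin 2 × Fin 2)) ℂ) = 1 := by
    ext ⟨⟨i, j⟩, ⟨k, l⟩⟩ ⟨⟨i', j'⟩, ⟨k', l'⟩⟩
    simp only [regroup, Matrix.of_apply, Matrix.one_apply, Prod.mk.injEq]
    congr 1
    simp only [eq_iff_iff]
    tauto
  rw [this, Matrix.one_mulVec]
  simp only [dotProduct, tens, Pi.star_apply, star_mul', Fintype.sum_prod_type, Fin.sum_univ_two]
  ring

lemma trace_eq_betaForm (φ τ : Fin 2 × Fin 2 → ℂ)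
    (P : Matrix ((Fin 2 × Fin 2) × (Fin 2 × Fin 2)) ((Fin 2 × Fin 2) × (Fin 2 × Fin 2)) ℂ) :
    ((proj φ ⊗ₖ proj τ) * regroup P).trace = betaForm (tens φ τ) (tens φ τ) P := by
  change _ = star _ ⬝ᵥ (regroup P *ᵥ _)
  have : proj φ ⊗ₖ proj τ = proj (tens φ τ) := by
    ext i j
    simp [proj, tens, Matrix.vecMulVec_apply, Matrix.kroneckerMap_apply]
    ring
  rw [this, proj, Matrix.trace_mul_comm, Matrix.mul_vecMulVec, Matrix.trace_vecMulVec,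
    dotProduct_comm]

/-- Basis vector. -/
def eVec (i : Fin 2 × Fin 2) : Fin 2 × Fin 2 → ℂ := Pi.single i 1

/-- The dual functional. -/
def dualForm (ε : ℝ) :
    Matrix ((Fin 2 × Fin 2) × (Fin 2 × Fin 2)) ((Fin 2 × Fin 2) × (Fin 2 × Fin 2)) ℂ →ₗ[ℂ] ℂ :=
  (∑ j : Fin 4, betaForm (tens (bellVec j) (tauVec ε)) (tens (bellVec j) (tauVec ε))) +
  (Real.sqrt (1 - ε ^ 2) : ℂ) •
    (betaForm (tens (bellVec 3) (eVec (0, 1))) (tens (bellVec 3) (eVec (0, 1)))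
    + betaForm (tens (bellVec 3) (eVec (1, 0))) (tens (bellVec 3) (eVec (1, 0)))
    - betaForm (tens (bellVec 3) (eVec (0, 0))) (tens (bellVec 3) (eVec (1, 1)))
    - betaForm (tens (bellVec 3) (eVec (1, 1))) (tens (bellVec 3) (eVec (0, 0))))

lemma inv_sqrt_two_sq : ((Real.sqrt 2 : ℂ))⁻¹ * ((Real.sqrt 2 : ℂ))⁻¹ = 1 / 2 := by
  rw [← mul_inv, ← Complex.ofReal_mul, Real.mul_self_sqrt (by norm_num)]; norm_num

lemma bell_norm (j : Fin 4) : star (bellVec j) ⬝ᵥ bellVec j = 1 := by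
  have h := inv_sqrt_two_sq
  fin_cases j <;>
  simp [bellVec, dotProduct, Fintype.sum_prod_type, Fin.sum_univ_two, h] <;> norm_num

lemma tau_norm (ε : ℝ) (hε : ε ∈ Set.Icc (0 : ℝ) 1) : star (tauVec ε) ⬝ᵥ tauVec ε = 1 := by
  obtain ⟨h0, h1⟩ := hε
  have e1 : (Real.sqrt ((1 + ε) / 2) : ℂ) * (Real.sqrt ((1 + ε) / 2) : ℂ) = (1 + ε) / 2 := by
    rw [← Complex.ofReal_mul, Real.mul_self_sqrt (by linarith)]; push_cast; ring
  have e2 : (Real.sqrt ((1 - ε) / 2) : ℂ) * (Real.sqrt ((1 - ε) / 2) : ℂ) = (1 - ε) / 2 := by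
    rw [← Complex.ofReal_mul, Real.mul_self_sqrt (by linarith)]; push_cast; ring
  have : star (tauVec ε) ⬝ᵥ tauVec ε = (Real.sqrt ((1 + ε) / 2) : ℂ) * (Real.sqrt ((1 + ε) / 2) : ℂ)
    + (Real.sqrt ((1 - ε) / 2) : ℂ) * (Real.sqrt ((1 - ε) / 2) : ℂ) := by
    simp only [tauVec, dotProduct, Fintype.sum_prod_type, Fin.sum_univ_two, Pi.star_apply]
    simp
  rw [this, e1, e2]; ring

lemma dual_one (ε : ℝ) (hε : ε ∈ Set.Icc (0 : ℝ) 1) :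
    dualForm ε 1 = 4 + 2 * (Real.sqrt (1 - ε ^ 2) : ℂ) := by
  simp only [dualForm, LinearMap.add_apply, LinearMap.sub_apply, LinearMap.smul_apply,
    LinearMap.sum_apply, betaForm_one, bell_norm, tau_norm ε hε, Fin.sum_univ_four]
  simp [eVec, dotProduct, Fintype.sum_prod_type, Fin.sum_univ_two, Pi.single_apply]
  ring

lemma psd_sum {α : Type*} [Fintype α] [DecidableEq α] {Q : Matrix α α ℂ} (h : Q.PosSemidef) :
    ∃ (m : ℕ) (f : Fin m → α → ℂ), Q = ∑ i, proj (f i) := by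
  exact Matrix.posSemidef_iff_eq_sum_vecMulVec.1 h

/-- The elementary inequality behind block positivity. -/
lemma key_norm (x y z t q : ℂ) (h : x ^ 2 = y ^ 2 + z ^ 2 + t ^ 2 + q) :
    ‖x‖ ^ 2 ≤ ‖y‖ ^ 2 + ‖z‖ ^ 2 + ‖t‖ ^ 2 + ‖q‖ := by
  rw [← norm_pow, h]
  refine (norm_add_le _ _).trans ?_
  have := norm_add_le (y ^ 2 + z ^ 2) (t ^ 2)
  have := norm_add_le (y ^ 2) (z ^ 2)
  simp only [norm_pow] at *
  linarith

lemma amp_tau (ε : ℝ) (a b φ : Fin 2 × Fin 2 → ℂ) :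
    amp a b (tens φ (tauVec ε)) =
      (Real.sqrt ((1 + ε) / 2) : ℂ) * amp a b (tens φ (eVec (0, 0))) +
      (Real.sqrt ((1 - ε) / 2) : ℂ) * amp a b (tens φ (eVec (1, 1))) := by
  simp only [amp, dotProduct, tens, tauVec, eVec, Fintype.sum_prod_type, Fin.sum_univ_two,
    Pi.star_apply, Pi.single_apply]
  simp
  ring

lemma amp_e (a b φ : Fin 2 × Fin 2 → ℂ) (i j : Fin 2) :
    amp a b (tens φ (eVec (i, j))) =
      ∑ x, ∑ y, star (φ (x, y)) * (a (x, i) * b (y, j)) := by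
  simp only [amp, dotProduct, tens, eVec, Fintype.sum_prod_type, Fin.sum_univ_two,
    Pi.star_apply, Pi.single_apply, wVec]
  fin_cases i <;> fin_cases j <;> simp

/-- The real-variable core of the argument. -/
lemma core (T1 T2 : ℝ) (h1 : 0 ≤ T1) (h2 : 0 ≤ T2) (u v : Fin 4 → ℂ) (q r : ℂ)
    (hu : u 0 ^ 2 - u 1 ^ 2 - u 2 ^ 2 + u 3 ^ 2 = 0)
    (hv : v 0 ^ 2 - v 1 ^ 2 - v 2 ^ 2 + v 3 ^ 2 = 0)
    (huv : 2 * (q * r) = u 3 * v 3 - u 0 * v 0 + u 1 * v 1 + u 2 * v 2) (k : Fin 3) :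
    2 * ‖T1 * u k.castSucc + T2 * v k.castSucc‖ ^ 2 ≤
      (∑ j, ‖T1 * u j + T2 * v j‖ ^ 2) +
      2 * T1 * T2 * (‖q‖ ^ 2 + ‖r‖ ^ 2 - 2 * (u 3 * star (v 3)).re) := by
  set x := fun j => T1 * u j + T2 * v j with hx
  set d : ℂ := T1 * u 3 - T2 * v 3 with hd
  have hds : ‖d‖ ^ 2 = ‖x 3‖ ^ 2 - 4 * T1 * T2 * (u 3 * star (v 3)).re := by
    simp only [hd, hx, ← Complex.normSq_eq_norm_sq, Complex.normSq_apply]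
    simp
    ring
  have hrel : x 0 ^ 2 - x 1 ^ 2 - x 2 ^ 2 + d ^ 2 = - (4 * T1 * T2 * (q * r)) := by
    simp only [hd, hx]
    linear_combination T1 ^ 2 * hu + T2 ^ 2 * hv + 2 * T1 * T2 * huv
  have hq : ‖(4 * T1 * T2 * (q * r) : ℂ)‖ ≤ 2 * T1 * T2 * (‖q‖ ^ 2 + ‖r‖ ^ 2) := by
    simp only [norm_mul, Complex.norm_real, Real.norm_of_nonneg h1, Real.norm_of_nonneg h2]
    have := mul_nonneg (mul_nonneg h1 h2) (sq_nonneg (‖q‖ - ‖r‖))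
    norm_num
    nlinarith
  have hI : ∀ w : ℂ, ‖Complex.I * w‖ = ‖w‖ := fun w => by simp
  have hk : ‖x k.castSucc‖ ^ 2 * 2 ≤ ‖x 0‖ ^ 2 + ‖x 1‖ ^ 2 + ‖x 2‖ ^ 2 + ‖d‖ ^ 2
      + ‖(4 * T1 * T2 * (q * r) : ℂ)‖ := by
    fin_cases k
    · have := key_norm (x 0) (x 1) (x 2) (Complex.I * d) (-(4 * T1 * T2 * (q * r))) (by
        rw [mul_pow, Complex.I_sq]; linear_combination hrel)
      rw [hI, norm_neg] at this
      change ‖x 0‖ ^ 2 * 2 ≤ _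
      linarith
    · have := key_norm (x 1) (x 0) (Complex.I * x 2) d ((4 * T1 * T2 * (q * r))) (by
        rw [mul_pow, Complex.I_sq]; linear_combination -hrel)
      rw [hI] at this
      change ‖x 1‖ ^ 2 * 2 ≤ _
      linarith
    · have := key_norm (x 2) (x 0) (Complex.I * x 1) d ((4 * T1 * T2 * (q * r))) (by
        rw [mul_pow, Complex.I_sq]; linear_combination -hrel)
      rw [hI] at this
      change ‖x 2‖ ^ 2 * 2 ≤ _
      linarith
  rw [Fin.sum_univ_four]
  change 2 * ‖x k.castSucc‖ ^ 2 ≤ ‖x 0‖ ^ 2 + ‖x 1‖ ^ 2 + ‖x 2‖ ^ 2 + ‖x 3‖ ^ 2 + _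
  linarith

lemma mul_star_re (z : ℂ) : (z * star z).re = ‖z‖ ^ 2 := by
  rw [← Complex.normSq_eq_norm_sq, Complex.normSq_apply]; simp

lemma sqrt_factor (ε : ℝ) (hε : ε ∈ Set.Icc (0 : ℝ) 1) :
    Real.sqrt (1 - ε ^ 2) = 2 * Real.sqrt ((1 + ε) / 2) * Real.sqrt ((1 - ε) / 2) := by
  obtain ⟨h0, h1⟩ := hε
  rw [mul_assoc, ← Real.sqrt_mul (by linarith), Real.sqrt_eq_iff_mul_self_eq (by nlinarith)
    (by positivity)]
  have := Real.mul_self_sqrt (show 0 ≤ (1 + ε) / 2 * ((1 - ε) / 2) by nlinarith)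
  linear_combination (-4) * this

lemma product_bound (ε : ℝ) (hε : ε ∈ Set.Icc (0 : ℝ) 1) (a b : Fin 2 × Fin 2 → ℂ) (k : Fin 3) :
    2 * (betaForm (tens (bellVec k.castSucc) (tauVec ε)) (tens (bellVec k.castSucc) (tauVec ε))
      (proj a ⊗ₖ proj b)).re ≤ (dualForm ε (proj a ⊗ₖ proj b)).re := by
  have hs := inv_sqrt_two_sq
  have := core (Real.sqrt ((1 + ε) / 2)) (Real.sqrt ((1 - ε) / 2)) (Real.sqrt_nonneg _)
    (Real.sqrt_nonneg _) (fun j => amp a b (tens (bellVec j) (eVec (0, 0))))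
    (fun j => amp a b (tens (bellVec j) (eVec (1, 1))))
    (amp a b (tens (bellVec 3) (eVec (0, 1)))) (amp a b (tens (bellVec 3) (eVec (1, 0))))
    (by
      simp [amp_e, bellVec]
      ring)
    (by
      simp [amp_e, bellVec]
      ring)
    (by
      simp [amp_e, bellVec]
      ring) k
  simp only [dualForm, LinearMap.add_apply, LinearMap.sub_apply, LinearMap.smul_apply,
    LinearMap.sum_apply, betaForm_proj, Complex.add_re, Complex.re_sum, mul_star_re, smul_eq_mul,
    Complex.re_ofReal_mul, Complex.sub_re]
  rw [sqrt_factor ε hε]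
  simp only [amp_tau] at *
  refine this.trans (le_of_eq ?_)
  congr 1
  have hc : ∀ x y : ℂ, (y * star x).re = (x * star y).re := fun x y => by simp; ring
  rw [hc (amp a b (tens (bellVec 3) (eVec (0, 0)))) (amp a b (tens (bellVec 3) (eVec (1, 1))))]
  ring

lemma sep_bound (ε : ℝ) (hε : ε ∈ Set.Icc (0 : ℝ) 1)
    (P : Matrix ((Fin 2 × Fin 2) × (Fin 2 × Fin 2)) ((Fin 2 × Fin 2) × (Fin 2 × Fin 2)) ℂ)
    (hP : SepMat P) (k : Fin 3) :
    2 * (betaForm (tens (bellVec k.castSucc) (tauVec ε)) (tens (bellVec k.castSucc) (tauVec ε))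
      P).re ≤ (dualForm ε P).re := by
  obtain ⟨M, Q, R, hQ, hR, rfl⟩ := hP
  simp only [map_sum, Complex.re_sum, Finset.mul_sum]
  refine Finset.sum_le_sum fun j _ => ?_
  obtain ⟨m, f, hf⟩ := psd_sum (hQ j)
  obtain ⟨n, g, hg⟩ := psd_sum (hR j)
  have : Q j ⊗ₖ R j = ∑ i, ∑ l, proj (f i) ⊗ₖ proj (g l) := by
    rw [hf, hg]
    ext x y
    simp only [Matrix.kroneckerMap_apply, Matrix.sum_apply, Finset.sum_mul_sum]
  rw [this]
  simp only [map_sum, Complex.re_sum, Finset.mul_sum]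
  exact Finset.sum_le_sum fun i _ => Finset.sum_le_sum fun l _ => product_bound ε hε _ _ k

/-- The success probability of any separable measurement at discriminating three Bell states
assisted by the resource state `τ_ε` (uniform prior) is at most `(2 + √(1 − ε²))/3`. -/
theorem three_bell_sep_bound (ε : ℝ) (hε : ε ∈ Set.Icc (0 : ℝ) 1)
    (P : Fin 3 → Matrix ((Fin 2 × Fin 2) × (Fin 2 × Fin 2))
      ((Fin 2 × Fin 2) × (Fin 2 × Fin 2)) ℂ)
    (hsep : ∀ k, SepMat (P k)) (hsum : ∑ k, P k = 1) :
    (1 / 3 : ℝ) * ∑ k : Fin 3,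
        (((proj (bellVec k.castSucc) ⊗ₖ proj (tauVec ε)) * regroup (P k)).trace).re ≤
      (2 + Real.sqrt (1 - ε ^ 2)) / 3 := by
  have h := Finset.sum_le_sum fun k (_ : k ∈ Finset.univ) => sep_bound ε hε (P k) (hsep k) k
  rw [← Complex.re_sum, ← map_sum, hsum, dual_one ε hε, ← Finset.mul_sum] at h
  simp only [trace_eq_betaForm]
  simp at h
  linarith
end
end

section
/- Let X₁ = X₂ = Y₁ = Y₂ = ℂ² and let ε ∈ [0,1]. If there exists a separable measurement {P₁, P₂, P₃} on (X₁⊗X₂) : (Y₁⊗Y₂) that perfectly discriminates the three states φ_k ⊗ τ_ε (k = 1, 2, 3), i.e. ⟨φ_k ⊗ τ_ε, W P_k W*⟩ = 1 for each k, then ε = 0; that is, the ancillary pair of qubits must be maximally entangled in order for three Bell states to be perfectly discriminated by separable measurements. -/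
open Matrix Complex
open scoped Matrix Kronecker ComplexOrder

noncomputable section

/-- Bessel inequality for two orthogonal vectors of the same norm. -/
lemma bessel_two {ι : Type*} [Fintype ι] (u w b : ι → ℂ) (N : ℝ)
    (hu : star u ⬝ᵥ u = (N : ℂ)) (hw : star w ⬝ᵥ w = (N : ℂ)) (huw : star u ⬝ᵥ w = 0) :
    ‖star u ⬝ᵥ b‖ ^ 2 + ‖star w ⬝ᵥ b‖ ^ 2 ≤ N * (star b ⬝ᵥ b).re := by
  have nn : ∀ v : ι → ℂ, 0 ≤ star v ⬝ᵥ v := fun v => dotProduct_star_self_nonneg v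
  have hN : 0 ≤ N := by have := nn u; rw [hu] at this; exact_mod_cast this
  rcases hN.eq_or_lt with h0 | hpos
  · subst h0
    have h1 : u = 0 := by simpa using hu
    have h2 : w = 0 := by simpa using hw
    simp [h1, h2]
  set p := star u ⬝ᵥ b with hp
  set q := star w ⬝ᵥ b with hq
  have hwu : star w ⬝ᵥ u = 0 := by
    rw [star_dotProduct, huw, star_zero]
  have hp' : star b ⬝ᵥ u = star p := by
    rw [hp, star_dotProduct]
  have hq' : star b ⬝ᵥ w = star q := by
    rw [hq, star_dotProduct]
  have key := nn ((N : ℂ) • b - p • u - q • w)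
  have e : star ((N : ℂ) • b - p • u - q • w) ⬝ᵥ ((N : ℂ) • b - p • u - q • w)
      = N * (N * (star b ⬝ᵥ b) - p * star p - q * star q) := by
    simp only [star_sub, star_smul, sub_dotProduct, dotProduct_sub, smul_dotProduct,
      dotProduct_smul, smul_eq_mul, hp', hq', hu, hw, huw, hwu, ← hp, ← hq]
    have : star (N : ℂ) = N := Complex.conj_ofReal N
    rw [this]; ring
  rw [e] at key
  have k2 := (Complex.le_def.1 key).1
  rw [Complex.re_ofReal_mul] at k2
  have k3 := nonneg_of_mul_nonneg_right k2 hpos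
  have m : ∀ z : ℂ, z * star z = ((‖z‖ ^ 2 : ℝ) : ℂ) := fun z => by
    rw [Complex.star_def, Complex.mul_conj, Complex.normSq_eq_norm_sq]
  rw [m, m] at k3
  simp only [Complex.sub_re, Complex.re_ofReal_mul, Complex.ofReal_re] at k3
  linarith

lemma trace_proj_mul {ι : Type*} [Fintype ι] (v w : ι → ℂ) :
    (proj v * proj w).trace = ((‖star v ⬝ᵥ w‖ ^ 2 : ℝ) : ℂ) := by
  have : (‖star v ⬝ᵥ w‖ ^ 2 : ℝ) = (star v ⬝ᵥ w) * star (star v ⬝ᵥ w) := by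
    rw [Complex.star_def, Complex.mul_conj, Complex.normSq_eq_norm_sq]
  rw [this, proj, proj, vecMulVec_mul_vecMulVec, trace_vecMulVec, star_dotProduct, star_star]
  simp [dotProduct_comm, mul_comm]

lemma proj_kron {α β : Type*} (u : α → ℂ) (v : β → ℂ) :
    proj u ⊗ₖ proj v = proj (tens u v) := by
  ext r c
  simp [proj, tens, vecMulVec_apply, kroneckerMap_apply]; ring

open scoped MatrixOrder Matrix.Norms.L2Operator in
lemma psd_sum_proj {α : Type*} [Fintype α] [DecidableEq α] {Q : Matrix α α ℂ}
    (h : Q.PosSemidef) : ∃ v : α → α → ℂ, Q = ∑ l, proj (v l) := by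
  obtain ⟨B, rfl⟩ := CStarAlgebra.nonneg_iff_eq_star_mul_self.1 h.nonneg
  refine ⟨fun l => star (B l), ?_⟩
  ext i j
  rw [star_eq_conjTranspose]
  simp [mul_apply, Matrix.sum_apply, proj, vecMulVec_apply]

abbrev Q2 := Fin 2 × Fin 2

/-- weights -/
def gw (d : Fin 2 → ℝ) : Q2 × Q2 → ℂ := fun r => (d r.1.2 * d r.2.2 : ℝ)

/-- the vector of the partially transposed term -/
def Fv (s : ℝ) : Q2 × Q2 → ℂ := fun r =>
  if r.1.1 = r.2.1 then (if r.1.2 = 0 ∧ r.2.2 = 1 then (s : ℂ)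
    else if r.1.2 = 1 ∧ r.2.2 = 0 then -(s : ℂ) else 0) else 0

/-- the dual functional, common part -/
def Lcom (d : Fin 2 → ℝ) (s : ℝ) : Matrix (Q2 × Q2) (Q2 × Q2) ℂ →ₗ[ℂ] ℂ where
  toFun P := (diagonal (gw d) * P).trace - (proj (Fv s) * ptFst P).trace
  map_add' P P' := by
    have : ptFst (P + P') = ptFst P + ptFst P' := rfl
    rw [this]; simp only [mul_add, trace_add]; ring
  map_smul' c P := by
    have : ptFst (c • P) = c • ptFst P := rfl
    rw [this]; simp only [mul_smul_comm, trace_smul, RingHom.id_apply, smul_sub]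

/-- success functional -/
def Lsuc (v t : Q2 → ℂ) : Matrix (Q2 × Q2) (Q2 × Q2) ℂ →ₗ[ℂ] ℂ where
  toFun P := ((proj v ⊗ₖ proj t) * regroup P).trace
  map_add' P P' := by
    have : regroup (P + P') = regroup P + regroup P' := rfl
    rw [this]; simp only [mul_add, trace_add]
  map_smul' c P := by
    have : regroup (c • P) = c • regroup P := rfl
    rw [this]; simp only [mul_smul_comm, trace_smul, RingHom.id_apply]

lemma Lcom_proj (d : Fin 2 → ℝ) (s : ℝ) (a b : Q2 → ℂ) :
    Lcom d s (proj a ⊗ₖ proj b) =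
      ((((∑ x : Q2, d x.2 * ‖a x‖ ^ 2) * (∑ y : Q2, d y.2 * ‖b y‖ ^ 2)
        - ‖star (Fv s) ⬝ᵥ tens (star a) b‖ ^ 2 : ℝ)) : ℂ) := by
  have h1 : ptFst (proj a ⊗ₖ proj b) = proj (tens (star a) b) := by
    ext r c
    simp [ptFst, proj, tens, vecMulVec_apply, kroneckerMap_apply]; ring
  change (diagonal (gw d) * (proj a ⊗ₖ proj b)).trace
    - (proj (Fv s) * ptFst (proj a ⊗ₖ proj b)).trace = _
  rw [h1, trace_proj_mul, Complex.ofReal_sub]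
  congr 1
  rw [Finset.sum_mul_sum, trace, Fintype.sum_prod_type]
  push_cast
  refine Finset.sum_congr rfl fun x _ => Finset.sum_congr rfl fun y _ => ?_
  have m : ∀ z : ℂ, z * star z = (‖z‖ : ℂ) ^ 2 := fun z => by
    rw [Complex.star_def, Complex.mul_conj, Complex.normSq_eq_norm_sq]; push_cast; rfl
  rw [← m, ← m]
  simp [diag_apply, diagonal_mul, proj, vecMulVec_apply, kroneckerMap_apply, gw]; ring

lemma Lsuc_proj (v t a b : Q2 → ℂ) :
    Lsuc v t (proj a ⊗ₖ proj b) =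
      ((‖star (tens v t) ⬝ᵥ (fun r : Q2 × Q2 => a (r.1.1, r.2.1) * b (r.1.2, r.2.2))‖ ^ 2 : ℝ) : ℂ)
      := by
  have h1 : regroup (proj a ⊗ₖ proj b) =
      proj (fun r : Q2 × Q2 => a (r.1.1, r.2.1) * b (r.1.2, r.2.2)) := by
    ext r c
    simp [regroup, proj, vecMulVec_apply, kroneckerMap_apply]; ring
  change ((proj v ⊗ₖ proj t) * regroup (proj a ⊗ₖ proj b)).trace = _
  rw [h1, proj_kron, trace_proj_mul]

/-- key inequality: Breuer–Hall -/
lemma core_s4 (ε e0 e1 : ℝ) (h0 : Real.sqrt ((1 + ε) / 2) = e0 ^ 2)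
    (h1 : Real.sqrt ((1 - ε) / 2) = e1 ^ 2) (k : Fin 3) (a b : Q2 → ℂ) :
    2 * ‖star (tens (bellVec k.castSucc) (tauVec ε)) ⬝ᵥ
      (fun r : Q2 × Q2 => a (r.1.1, r.2.1) * b (r.1.2, r.2.2))‖ ^ 2
    + ‖star (Fv (e0 * e1)) ⬝ᵥ tens (star a) b‖ ^ 2 ≤
    (∑ x : Q2, ![e0 ^ 2, e1 ^ 2] x.2 * ‖a x‖ ^ 2) *
      (∑ y : Q2, ![e0 ^ 2, e1 ^ 2] y.2 * ‖b y‖ ^ 2) := by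
  have hr : (Real.sqrt 2 : ℝ) ^ 2 = 2 := Real.sq_sqrt (by norm_num)
  -- scaled vectors
  let e : Fin 2 → ℝ := ![e0, e1]
  let a' : Q2 → ℂ := fun x => e x.2 * a x
  let b' : Q2 → ℂ := fun x => e x.2 * b x
  let w : Q2 → ℂ := fun y => ![-a' (y.1, 1), a' (y.1, 0)] y.2
  let u : Q2 → ℂ := fun y =>
    (![![star (a' (0, y.2)), star (a' (1, y.2))],
       ![star (a' (0, y.2)), -star (a' (1, y.2))],
       ![star (a' (1, y.2)), star (a' (0, y.2))]] k) y.1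
  have m : ∀ z : ℂ, (‖z‖ : ℂ) ^ 2 = z * star z := fun z => by
    rw [Complex.star_def, Complex.mul_conj, Complex.normSq_eq_norm_sq]; push_cast; rfl
  have B := bessel_two u w b' (∑ x : Q2, ![e0 ^ 2, e1 ^ 2] x.2 * ‖a x‖ ^ 2)
    (by
      push_cast
      simp only [m]
      fin_cases k <;>
      simp [u, a', e, dotProduct, Fintype.sum_prod_type, Fin.sum_univ_two] <;> ring)
    (by
      push_cast
      simp only [m]
      simp [w, a', e, dotProduct, Fintype.sum_prod_type, Fin.sum_univ_two]; ring)
    (by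
      fin_cases k <;>
      simp [u, w, a', e, dotProduct, Fintype.sum_prod_type, Fin.sum_univ_two] <;> ring)
  have hb : (star b' ⬝ᵥ b').re = ∑ y : Q2, ![e0 ^ 2, e1 ^ 2] y.2 * ‖b y‖ ^ 2 := by
    have : star b' ⬝ᵥ b' = ((∑ y : Q2, ![e0 ^ 2, e1 ^ 2] y.2 * ‖b y‖ ^ 2 : ℝ) : ℂ) := by
      push_cast
      simp only [m]
      simp [b', e, dotProduct, Fintype.sum_prod_type, Fin.sum_univ_two]; ring
    rw [this, Complex.ofReal_re]
  rw [hb] at B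
  have hw : star (Fv (e0 * e1)) ⬝ᵥ tens (star a) b = star w ⬝ᵥ b' := by
    simp [w, a', b', e, Fv, tens, dotProduct, Fintype.sum_prod_type, Fin.sum_univ_two]; ring
  have hu : star (tens (bellVec k.castSucc) (tauVec ε)) ⬝ᵥ
      (fun r : Q2 × Q2 => a (r.1.1, r.2.1) * b (r.1.2, r.2.2))
      = ((Real.sqrt 2)⁻¹ : ℝ) * (star u ⬝ᵥ b') := by
    fin_cases k <;>
    simp [u, a', b', e, bellVec, tauVec, tens, dotProduct, Fintype.sum_prod_type,
      Fin.sum_univ_two, h0, h1] <;> ring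
  rw [hw, hu, norm_mul, mul_pow, Complex.norm_real, Real.norm_eq_abs, sq_abs, inv_pow, hr]
  linarith

lemma L_nonneg (ε e0 e1 : ℝ) (h0 : Real.sqrt ((1 + ε) / 2) = e0 ^ 2)
    (h1 : Real.sqrt ((1 - ε) / 2) = e1 ^ 2) (k : Fin 3)
    (P : Matrix (Q2 × Q2) (Q2 × Q2) ℂ) (hP : SepMat P) :
    0 ≤ (Lcom ![e0 ^ 2, e1 ^ 2] (e0 * e1) - (2 : ℂ) • Lsuc (bellVec k.castSucc) (tauVec ε)) P := by
  obtain ⟨M, Q, R, hQ, hR, rfl⟩ := hP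
  rw [map_sum]
  refine Finset.sum_nonneg fun j _ => ?_
  obtain ⟨v, hv⟩ := psd_sum_proj (hQ j)
  obtain ⟨w, hw⟩ := psd_sum_proj (hR j)
  have : Q j ⊗ₖ R j = ∑ l, ∑ n, proj (v l) ⊗ₖ proj (w n) := by
    rw [hv, hw]
    ext r c
    simp [kroneckerMap_apply, Matrix.sum_apply, Finset.sum_mul_sum]
  rw [this, map_sum]
  refine Finset.sum_nonneg fun l _ => ?_
  rw [map_sum]
  refine Finset.sum_nonneg fun n _ => ?_
  rw [LinearMap.sub_apply, LinearMap.smul_apply, Lcom_proj, Lsuc_proj, smul_eq_mul]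
  have := core_s4 ε e0 e1 h0 h1 k (v l) (w n)
  rw [← Complex.ofReal_ofNat, ← Complex.ofReal_mul, ← Complex.ofReal_sub, Complex.zero_le_real]
  linarith

lemma Lcom_one (e0 e1 : ℝ) : Lcom ![e0 ^ 2, e1 ^ 2] (e0 * e1) 1 =
    ((4 * (e0 ^ 2 + e1 ^ 2) ^ 2 - 4 * (e0 * e1) ^ 2 : ℝ) : ℂ) := by
  have hpt : ptFst (1 : Matrix (Q2 × Q2) (Q2 × Q2) ℂ) = 1 := by
    ext ⟨r1, r2⟩ ⟨c1, c2⟩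
    simp only [ptFst, of_apply, one_apply, Prod.mk.injEq]
    congr 1
    simp [eq_comm]
  change (diagonal (gw _) * 1).trace - (proj (Fv _) * ptFst 1).trace = _
  rw [hpt, mul_one, mul_one]
  simp [trace, proj, vecMulVec_apply, Fv, gw, Fintype.sum_prod_type, Fin.sum_univ_two]
  ring


/-- If a separable measurement perfectly discriminates the three Bell states `φ₁, φ₂, φ₃`
assisted by the resource state `τ_ε`, then `ε = 0`: the ancillary pair of qubits must be
maximally entangled. -/
theorem three_bell_perfect_sep_requires_maximally_entangled
    (ε : ℝ) (hε : ε ∈ Set.Icc (0 : ℝ) 1)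
    (P : Fin 3 → Matrix ((Fin 2 × Fin 2) × (Fin 2 × Fin 2))
      ((Fin 2 × Fin 2) × (Fin 2 × Fin 2)) ℂ)
    (hsep : ∀ k, SepMat (P k)) (hsum : ∑ k, P k = 1)
    (hperfect : ∀ k : Fin 3,
      ((proj (bellVec k.castSucc) ⊗ₖ proj (tauVec ε)) * regroup (P k)).trace = 1) :
    ε = 0 := by
  obtain ⟨hε0, hε1⟩ := hε
  set D0 := Real.sqrt ((1 + ε) / 2) with hD0
  set D1 := Real.sqrt ((1 - ε) / 2) with hD1
  have h0 : D0 = Real.sqrt D0 ^ 2 := (Real.sq_sqrt (Real.sqrt_nonneg _)).symm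
  have h1 : D1 = Real.sqrt D1 ^ 2 := (Real.sq_sqrt (Real.sqrt_nonneg _)).symm
  have hL := fun k => L_nonneg ε (Real.sqrt D0) (Real.sqrt D1) h0 h1 k (P k) (hsep k)
  have hs : 0 ≤ ∑ k, (Lcom ![Real.sqrt D0 ^ 2, Real.sqrt D1 ^ 2] (Real.sqrt D0 * Real.sqrt D1)
      (P k) - 2) := by
    refine Finset.sum_nonneg fun k _ => ?_
    have h := hL k
    have e : Lsuc (bellVec k.castSucc) (tauVec ε) (P k) = 1 := hperfect k
    rw [LinearMap.sub_apply, LinearMap.smul_apply, e, smul_eq_mul, mul_one] at h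
    exact h
  rw [Finset.sum_sub_distrib, ← map_sum, hsum, Lcom_one] at hs
  have hs' := (Complex.le_def.1 hs).1
  rw [Complex.sub_re, Complex.ofReal_re, mul_pow, ← h0, ← h1] at hs'
  simp at hs'
  have q0 : D0 ^ 2 = (1 + ε) / 2 := Real.sq_sqrt (by linarith)
  have q1 : D1 ^ 2 = (1 - ε) / 2 := Real.sq_sqrt (by linarith)
  have hd : 1 / 2 ≤ D0 * D1 := by nlinarith
  have hm : (D0 * D1) ^ 2 = (1 - ε ^ 2) / 4 := by rw [mul_pow, q0, q1]; ring
  have : ε ^ 2 ≤ 0 := by nlinarith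
  exact pow_eq_zero_iff (two_ne_zero) |>.1 (le_antisymm this (sq_nonneg ε))
end
end

section
/- Let X₁ = X₂ = Y₁ = Y₂ = ℂ², let ε ∈ (0,1), and define the Hermitian operator H_ε = (1/3)[ (1/2) · 1_{X₁⊗Y₁} ⊗ τ_ε + √(1 − ε²) · φ₄ ⊗ T_{X₂}(φ₄) ] on X₁⊗Y₁⊗X₂⊗Y₂. Then for each k ∈ {1, 2, 3}, the operator Q_{k,ε} = W*( H_ε − (1/3) φ_k ⊗ τ_ε )W on (X₁⊗X₂)⊗(Y₁⊗Y₂) is block positive with respect to the bipartition (X₁⊗X₂) : (Y₁⊗Y₂). -/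
open Matrix Complex
open scoped Matrix Kronecker ComplexOrder

noncomputable section

lemma blockCompress_isHermitian {α β : Type*} [Fintype β] {H : Matrix (α × β) (α × β) ℂ}
    (hH : H.IsHermitian) (y : β → ℂ) : (blockCompress H y).IsHermitian := by
  ext i j
  simp only [blockCompress, Matrix.conjTranspose_apply, Matrix.of_apply, star_sum, star_mul',
    star_star]
  rw [Finset.sum_comm]
  refine Finset.sum_congr rfl fun a _ => Finset.sum_congr rfl fun b _ => ?_
  rw [hH.apply]
  ring

lemma proj_isHermitian {α : Type*} (u : α → ℂ) : (proj u).IsHermitian := by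
  ext i j
  simp [proj, Matrix.vecMulVec_apply, mul_comm]

lemma ptFst_isHermitian {α β : Type*} {H : Matrix (α × β) (α × β) ℂ}
    (hH : H.IsHermitian) : (ptFst H).IsHermitian := by
  ext i j
  simp only [ptFst, Matrix.conjTranspose_apply, Matrix.of_apply]
  rw [hH.apply]

lemma regroup_isHermitian {α₁ α₂ β₁ β₂ : Type*}
    {M : Matrix ((α₁ × α₂) × (β₁ × β₂)) ((α₁ × α₂) × (β₁ × β₂)) ℂ}
    (hH : M.IsHermitian) : (regroup M).IsHermitian := by
  ext i j
  simp only [regroup, Matrix.conjTranspose_apply, Matrix.of_apply]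
  rw [hH.apply]

lemma kron_isHermitian {α β : Type*} {A : Matrix α α ℂ} {B : Matrix β β ℂ}
    (hA : A.IsHermitian) (hB : B.IsHermitian) : (A ⊗ₖ B).IsHermitian := by
  ext i j
  simp only [Matrix.conjTranspose_apply, Matrix.kroneckerMap_apply, star_mul']
  rw [hA.apply, hB.apply]

lemma smul_isHermitian {α : Type*} {A : Matrix α α ℂ} (c : ℂ) (hc : star c = c)
    (hA : A.IsHermitian) : (c • A).IsHermitian := by
  ext i j
  simp only [Matrix.conjTranspose_apply, Matrix.smul_apply, smul_eq_mul, star_mul']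
  rw [hA.apply, hc]

/-- The scalar inequality behind block positivity. -/
lemma key_ineq (p q r d n m : ℂ) (s : ℝ) (hs : 0 ≤ s)
    (h : ‖p ^ 2‖ ≤ ‖q ^ 2‖ + ‖r ^ 2‖ + ‖d ^ 2‖ + ‖2 * s * n * m‖) :
    (0 : ℂ) ≤ (1 / 6 : ℂ) * (q * star q + r * star r + d * star d
      + s * (n * star n + m * star m) - p * star p) := by
  have e : (1 / 6 : ℂ) * (q * star q + r * star r + d * star d
      + s * (n * star n + m * star m) - p * star p) =
      (((1 / 6 : ℝ) * (‖q‖ ^ 2 + ‖r‖ ^ 2 + ‖d‖ ^ 2 + s * (‖n‖ ^ 2 + ‖m‖ ^ 2) - ‖p‖ ^ 2) : ℝ) : ℂ) := by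
    have hz : ∀ z : ℂ, z * star z = ((‖z‖ ^ 2 : ℝ) : ℂ) := fun z => by
      simpa using Complex.mul_conj' z
    simp only [hz]
    push_cast
    ring
  rw [e]
  rw [Complex.zero_le_real]
  simp only [norm_pow, norm_mul, Complex.norm_real, Real.norm_of_nonneg hs, Complex.norm_ofNat] at h
  have : 0 ≤ s * (‖n‖ - ‖m‖) ^ 2 := by positivity
  nlinarith

lemma norm_four (a b c d e : ℂ) (h : a = b + c + d + e) : ‖a‖ ≤ ‖b‖ + ‖c‖ + ‖d‖ + ‖e‖ := by
  rw [h]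
  exact (norm_add_le _ _).trans (by gcongr; exact norm_add₃_le)

set_option maxHeartbeats 4000000 in
/-- For `ε ∈ (0,1)` and the dual solution
`H_ε = (1/3)[(1/2)·1_{X₁⊗Y₁} ⊗ τ_ε + √(1−ε²)·φ₄ ⊗ T_{X₂}(φ₄)]`,
each operator `Q_{k,ε} = W*(H_ε − (1/3)φ_k ⊗ τ_ε)W` is block positive with respect to the
bipartition `(X₁⊗X₂) : (Y₁⊗Y₂)`. -/
theorem three_bell_dual_feasible (ε : ℝ) (hε : ε ∈ Set.Ioo (0 : ℝ) 1) :
    ∀ k : Fin 3,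
      BlockPositive (α := Fin 2 × Fin 2) (β := Fin 2 × Fin 2)
        (regroup
          (((1 / 3 : ℂ) •
              ((1 / 2 : ℂ) • ((1 : Matrix (Fin 2 × Fin 2) (Fin 2 × Fin 2) ℂ) ⊗ₖ proj (tauVec ε))
                + (Real.sqrt (1 - ε ^ 2) : ℂ) • (proj (bellVec 3) ⊗ₖ ptFst (proj (bellVec 3)))))
            - (1 / 3 : ℂ) • (proj (bellVec k.castSucc) ⊗ₖ proj (tauVec ε)))) := by
  intro k y
  refine Matrix.PosSemidef.of_dotProduct_mulVec_nonneg ?_ ?_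
  · apply blockCompress_isHermitian
    apply regroup_isHermitian
    have hτ := proj_isHermitian (tauVec ε)
    refine (smul_isHermitian _ (by simp) ((smul_isHermitian _ (by simp)
      (kron_isHermitian Matrix.isHermitian_one hτ)).add (smul_isHermitian _ (by simp)
      (kron_isHermitian (proj_isHermitian _) (ptFst_isHermitian (proj_isHermitian _)))))).sub
      (smul_isHermitian _ (by simp) (kron_isHermitian (proj_isHermitian _) hτ))
  intro x
  obtain ⟨h0, h1⟩ := hε
  generalize hcd : ((Real.sqrt 2 : ℂ))⁻¹ = c
  have hc2 : c ^ 2 = 1 / 2 := by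
    rw [← hcd, inv_pow, ← Complex.ofReal_pow, Real.sq_sqrt (by norm_num)]; norm_num
  have hc4 : c ^ 4 = 1 / 4 := by
    rw [show c ^ 4 = (c ^ 2) ^ 2 by ring, hc2]; norm_num
  have hc' : star c = c := by rw [← hcd]; simp
  have hc'' : (starRingEnd ℂ) c = c := hc'
  generalize ht0d : (Real.sqrt ((1 + ε) / 2) : ℂ) = t0
  generalize ht1d : (Real.sqrt ((1 - ε) / 2) : ℂ) = t1
  have ht0' : star t0 = t0 := by rw [← ht0d]; simp
  have ht1' : star t1 = t1 := by rw [← ht1d]; simp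
  have ht0'' : (starRingEnd ℂ) t0 = t0 := ht0'
  have ht1'' : (starRingEnd ℂ) t1 = t1 := ht1'
  have hs : (Real.sqrt (1 - ε ^ 2) : ℂ) = 2 * t0 * t1 := by
    rw [← ht0d, ← ht1d, mul_assoc, ← Complex.ofReal_mul, ← Real.sqrt_mul (by linarith)]
    rw [show (1 + ε) / 2 * ((1 - ε) / 2) = (1 - ε ^ 2) / 2 ^ 2 by ring,
      Real.sqrt_div' _ (by norm_num), Real.sqrt_sq (by norm_num)]
    push_cast
    ring
  have e00 : tauVec ε (0, 0) = t0 := by rw [← ht0d]; simp [tauVec]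
  have e01 : tauVec ε (0, 1) = 0 := by simp [tauVec]
  have e10 : tauVec ε (1, 0) = 0 := by simp [tauVec]
  have e11 : tauVec ε (1, 1) = t1 := by rw [← ht1d]; simp [tauVec]
  fin_cases k

  · have h := key_ineq (c * (t0 * (x (0, 0)*y (0, 0)) + t1 * (x (0, 1)*y (0, 1)) + t0*(x (1, 0)*y (1, 0)) + t1*(x (1, 1)*y (1, 1)))) (c * (t0 * (x (0, 0)*y (0, 0)) + t1 * (x (0, 1)*y (0, 1)) - t0*(x (1, 0)*y (1, 0)) - t1*(x (1, 1)*y (1, 1)))) (c * (t0 * (x (0, 0)*y (1, 0)) + t1 * (x (0, 1)*y (1, 1)) + t0*(x (1, 0)*y (0, 0)) + t1*(x (1, 1)*y (0, 1))))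
      (c * (t0 * (x (0, 0) * y (1, 0) - x (1, 0) * y (0, 0)) - t1 * (x (0, 1) * y (1, 1) - x (1, 1) * y (0, 1))))
      (c * (x (0, 0) * y (1, 1) - x (1, 0) * y (0, 1)))
      (c * (x (0, 1) * y (1, 0) - x (1, 1) * y (0, 0))) (Real.sqrt (1 - ε ^ 2))
      (Real.sqrt_nonneg _) (by
        have := norm_four ((c * (t0 * (x (0, 0)*y (0, 0)) + t1 * (x (0, 1)*y (0, 1)) + t0*(x (1, 0)*y (1, 0)) + t1*(x (1, 1)*y (1, 1)))) ^ 2) (((c * (t0 * (x (0, 0)*y (0, 0)) + t1 * (x (0, 1)*y (0, 1)) - t0*(x (1, 0)*y (1, 0)) - t1*(x (1, 1)*y (1, 1))))^2))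
          (((c * (t0 * (x (0, 0)*y (1, 0)) + t1 * (x (0, 1)*y (1, 1)) + t0*(x (1, 0)*y (0, 0)) + t1*(x (1, 1)*y (0, 1))))^2)) (-((c * (t0 * (x (0, 0) * y (1, 0) - x (1, 0) * y (0, 0)) - t1 * (x (0, 1) * y (1, 1) - x (1, 1) * y (0, 1))))^2))
          (-(2 * (Real.sqrt (1 - ε ^ 2) : ℂ) * (c * (x (0, 0) * y (1, 1) - x (1, 0) * y (0, 1))) * (c * (x (0, 1) * y (1, 0) - x (1, 1) * y (0, 0))))) (by
            rw [hs]; ring)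
        simpa only [norm_neg] using this)
    convert h using 1
    simp only [hs, star_mul', star_add, star_sub, hc', ht0', ht1']
    simp only [bellVec, hcd, hs]
    simp [Matrix.mulVec, dotProduct, blockCompress, regroup, Fintype.sum_prod_type,
      Fin.sum_univ_two, proj, Matrix.vecMulVec_apply, ptFst, Matrix.one_apply,
      e00, e01, e10, e11, hc'', ht0'', ht1'']
    ring_nf
    simp only [hc2, hc4]
    ring

  · have h := key_ineq (c * (t0 * (x (0, 0)*y (0, 0)) + t1 * (x (0, 1)*y (0, 1)) - t0*(x (1, 0)*y (1, 0)) - t1*(x (1, 1)*y (1, 1)))) (c * (t0 * (x (0, 0)*y (0, 0)) + t1 * (x (0, 1)*y (0, 1)) + t0*(x (1, 0)*y (1, 0)) + t1*(x (1, 1)*y (1, 1)))) (c * (t0 * (x (0, 0)*y (1, 0)) + t1 * (x (0, 1)*y (1, 1)) + t0*(x (1, 0)*y (0, 0)) + t1*(x (1, 1)*y (0, 1))))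
      (c * (t0 * (x (0, 0) * y (1, 0) - x (1, 0) * y (0, 0)) - t1 * (x (0, 1) * y (1, 1) - x (1, 1) * y (0, 1))))
      (c * (x (0, 0) * y (1, 1) - x (1, 0) * y (0, 1)))
      (c * (x (0, 1) * y (1, 0) - x (1, 1) * y (0, 0))) (Real.sqrt (1 - ε ^ 2))
      (Real.sqrt_nonneg _) (by
        have := norm_four ((c * (t0 * (x (0, 0)*y (0, 0)) + t1 * (x (0, 1)*y (0, 1)) - t0*(x (1, 0)*y (1, 0)) - t1*(x (1, 1)*y (1, 1)))) ^ 2) (((c * (t0 * (x (0, 0)*y (0, 0)) + t1 * (x (0, 1)*y (0, 1)) + t0*(x (1, 0)*y (1, 0)) + t1*(x (1, 1)*y (1, 1))))^2))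
          (-((c * (t0 * (x (0, 0)*y (1, 0)) + t1 * (x (0, 1)*y (1, 1)) + t0*(x (1, 0)*y (0, 0)) + t1*(x (1, 1)*y (0, 1))))^2)) (((c * (t0 * (x (0, 0) * y (1, 0) - x (1, 0) * y (0, 0)) - t1 * (x (0, 1) * y (1, 1) - x (1, 1) * y (0, 1))))^2))
          ((2 * (Real.sqrt (1 - ε ^ 2) : ℂ) * (c * (x (0, 0) * y (1, 1) - x (1, 0) * y (0, 1))) * (c * (x (0, 1) * y (1, 0) - x (1, 1) * y (0, 0))))) (by
            rw [hs]; ring)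
        simpa only [norm_neg] using this)
    convert h using 1
    simp only [hs, star_mul', star_add, star_sub, hc', ht0', ht1']
    simp only [bellVec, hcd, hs]
    simp [Matrix.mulVec, dotProduct, blockCompress, regroup, Fintype.sum_prod_type,
      Fin.sum_univ_two, proj, Matrix.vecMulVec_apply, ptFst, Matrix.one_apply,
      e00, e01, e10, e11, hc'', ht0'', ht1'']
    ring_nf
    simp only [hc2, hc4]
    ring

  · have h := key_ineq (c * (t0 * (x (0, 0)*y (1, 0)) + t1 * (x (0, 1)*y (1, 1)) + t0*(x (1, 0)*y (0, 0)) + t1*(x (1, 1)*y (0, 1)))) (c * (t0 * (x (0, 0)*y (0, 0)) + t1 * (x (0, 1)*y (0, 1)) + t0*(x (1, 0)*y (1, 0)) + t1*(x (1, 1)*y (1, 1)))) (c * (t0 * (x (0, 0)*y (0, 0)) + t1 * (x (0, 1)*y (0, 1)) - t0*(x (1, 0)*y (1, 0)) - t1*(x (1, 1)*y (1, 1))))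
      (c * (t0 * (x (0, 0) * y (1, 0) - x (1, 0) * y (0, 0)) - t1 * (x (0, 1) * y (1, 1) - x (1, 1) * y (0, 1))))
      (c * (x (0, 0) * y (1, 1) - x (1, 0) * y (0, 1)))
      (c * (x (0, 1) * y (1, 0) - x (1, 1) * y (0, 0))) (Real.sqrt (1 - ε ^ 2))
      (Real.sqrt_nonneg _) (by
        have := norm_four ((c * (t0 * (x (0, 0)*y (1, 0)) + t1 * (x (0, 1)*y (1, 1)) + t0*(x (1, 0)*y (0, 0)) + t1*(x (1, 1)*y (0, 1)))) ^ 2) (((c * (t0 * (x (0, 0)*y (0, 0)) + t1 * (x (0, 1)*y (0, 1)) + t0*(x (1, 0)*y (1, 0)) + t1*(x (1, 1)*y (1, 1))))^2))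
          (-((c * (t0 * (x (0, 0)*y (0, 0)) + t1 * (x (0, 1)*y (0, 1)) - t0*(x (1, 0)*y (1, 0)) - t1*(x (1, 1)*y (1, 1))))^2)) (((c * (t0 * (x (0, 0) * y (1, 0) - x (1, 0) * y (0, 0)) - t1 * (x (0, 1) * y (1, 1) - x (1, 1) * y (0, 1))))^2))
          ((2 * (Real.sqrt (1 - ε ^ 2) : ℂ) * (c * (x (0, 0) * y (1, 1) - x (1, 0) * y (0, 1))) * (c * (x (0, 1) * y (1, 0) - x (1, 1) * y (0, 0))))) (by
            rw [hs]; ring)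
        simpa only [norm_neg] using this)
    convert h using 1
    simp only [hs, star_mul', star_add, star_sub, hc', ht0', ht1']
    simp only [bellVec, hcd, hs]
    simp [Matrix.mulVec, dotProduct, blockCompress, regroup, Fintype.sum_prod_type,
      Fin.sum_univ_two, proj, Matrix.vecMulVec_apply, ptFst, Matrix.one_apply,
      e00, e01, e10, e11, hc'', ht0'', ht1'']
    ring_nf
    simp only [hc2, hc4]
    ring
end
end

section
/- Let A = {u_k ⊗ v_k : k = 1, …, N} ⊂ ℂ^n ⊗ ℂ^m be an unextendable product set, and for each k let P_k denote the set of rank-one product projections xx* ⊗ yy* with unit vectors x ∈ ℂ^n, y ∈ ℂ^m such that x ⊗ y is orthogonal to every element of A \ {u_k ⊗ v_k}. Then each set P_k is finite. -/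
open Matrix Complex
open scoped Matrix Kronecker ComplexOrder

noncomputable section

theorem tens_dot {n m : ℕ} (u x : Fin n → ℂ) (v y : Fin m → ℂ) :
    star (tens u v) ⬝ᵥ tens x y = (star u ⬝ᵥ x) * (star v ⬝ᵥ y) := by
  simp only [dotProduct, tens, Fintype.sum_prod_type, Finset.sum_mul_sum, Pi.star_apply, star_mul']
  refine Finset.sum_congr rfl fun i _ => Finset.sum_congr rfl fun j _ => ?_
  ring

/-- Two unit vectors such that the functional `w*` is nonzero on both and is injective on
their span define the same projection. -/
theorem proj_eq_aux {n : ℕ} (w x x' : Fin n → ℂ)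
    (hx : star x ⬝ᵥ x = 1) (hx' : star x' ⬝ᵥ x' = 1)
    (ha : star w ⬝ᵥ x' ≠ 0)
    (hz : (star w ⬝ᵥ x') • x - (star w ⬝ᵥ x) • x' = 0) : proj x = proj x' := by
  obtain ⟨c, hc⟩ : ∃ c : ℂ, x = c • x' := by
    refine ⟨(star w ⬝ᵥ x')⁻¹ * (star w ⬝ᵥ x), ?_⟩
    rw [mul_smul, ← sub_eq_zero.mp hz, smul_smul, inv_mul_cancel₀ ha, one_smul]
  subst hc
  have h1 : c * star c = 1 := by
    simpa [star_smul, smul_dotProduct, dotProduct_smul, hx'] using hx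
  ext i j
  simp only [proj, vecMulVec_apply, Pi.smul_apply, Pi.star_apply, smul_eq_mul, star_mul']
  linear_combination (x' i * star (x' j)) * h1

/-- For an unextendable product set `{u_k ⊗ v_k}`, each set `P_k` of rank-one product
projections `xx* ⊗ yy*` with `x ⊗ y` a unit product vector orthogonal to every member of the
set other than the `k`-th one is finite. -/
theorem ups_replacement_sets_finite (n m N : ℕ)
    (u : Fin N → Fin n → ℂ) (v : Fin N → Fin m → ℂ)
    (horth : ∀ k l, star (tens (u k) (v k)) ⬝ᵥ tens (u l) (v l) = if k = l then 1 else 0)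
    (hups : ∀ (x : Fin n → ℂ) (y : Fin m → ℂ),
      (∀ k, star (tens (u k) (v k)) ⬝ᵥ tens x y = 0) → x = 0 ∨ y = 0)
    (k : Fin N) :
    Set.Finite {M : Matrix (Fin n × Fin m) (Fin n × Fin m) ℂ |
      ∃ (x : Fin n → ℂ) (y : Fin m → ℂ),
        star x ⬝ᵥ x = 1 ∧ star y ⬝ᵥ y = 1 ∧
        (∀ l, l ≠ k → star (tens (u l) (v l)) ⬝ᵥ tens x y = 0) ∧
        M = proj x ⊗ₖ proj y} := by
  simp only [tens_dot] at hups ⊢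
  have key : ∀ S : Set (Fin N), Set.Subsingleton
      {M : Matrix (Fin n × Fin m) (Fin n × Fin m) ℂ |
        ∃ (x : Fin n → ℂ) (y : Fin m → ℂ),
          star x ⬝ᵥ x = 1 ∧ star y ⬝ᵥ y = 1 ∧
          (∀ l, l ≠ k → l ∈ S → star (u l) ⬝ᵥ x = 0) ∧
          (∀ l, l ≠ k → l ∉ S → star (v l) ⬝ᵥ y = 0) ∧
          M = proj x ⊗ₖ proj y} := by
    rintro S _ ⟨x, y, hx, hy, hS, hT, rfl⟩ _ ⟨x', y', hx', hy', hS', hT', rfl⟩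
    have ne0 : ∀ {d : ℕ} (z : Fin d → ℂ), star z ⬝ᵥ z = 1 → z ≠ 0 := by
      rintro d z hz rfl
      simp at hz
    have gen : ∀ (a : Fin n → ℂ) (b : Fin m → ℂ),
        (∀ l, l ≠ k → l ∈ S → star (u l) ⬝ᵥ a = 0) →
        (∀ l, l ≠ k → l ∉ S → star (v l) ⬝ᵥ b = 0) →
        (star (u k) ⬝ᵥ a) * (star (v k) ⬝ᵥ b) = 0 → a = 0 ∨ b = 0 := by
      intro a b h1 h2 h3
      refine hups a b fun l => ?_
      by_cases hl : l = k
      · rw [hl, h3]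
      · by_cases hlS : l ∈ S
        · rw [h1 l hl hlS, zero_mul]
        · rw [h2 l hl hlS, mul_zero]
    have nz : (star (u k) ⬝ᵥ x') * (star (v k) ⬝ᵥ y') ≠ 0 := fun h =>
      (gen x' y' hS' hT' h).elim (ne0 _ hx') (ne0 _ hy')
    have e1 : proj x = proj x' := by
      refine proj_eq_aux (u k) x x' hx hx' (left_ne_zero_of_mul nz) ?_
      refine (gen _ y ?_ hT ?_).resolve_right (ne0 _ hy)
      · intro l hl hlS
        simp [dotProduct_sub, dotProduct_smul, hS l hl hlS, hS' l hl hlS]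
      · simp only [dotProduct_sub, dotProduct_smul, smul_eq_mul]
        ring
    have e2 : proj y = proj y' := by
      refine proj_eq_aux (v k) y y' hy hy' (right_ne_zero_of_mul nz) ?_
      refine (gen x _ hS ?_ ?_).resolve_left (ne0 _ hx)
      · intro l hl hlS
        simp [dotProduct_sub, dotProduct_smul, hT l hl hlS, hT' l hl hlS]
      · simp only [dotProduct_sub, dotProduct_smul, smul_eq_mul]
        ring
    rw [e1, e2]
  refine (Set.finite_iUnion fun S : Set (Fin N) => (key S).finite).subset ?_
  rintro M ⟨x, y, hx, hy, h, hM⟩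
  refine Set.mem_iUnion.mpr ⟨{l | star (u l) ⬝ᵥ x = 0}, x, y, hx, hy, fun l _ hl => hl, ?_, hM⟩
  intro l hl hlS
  exact (mul_eq_zero.mp (h l hl)).resolve_left hlS
end
end

section
/- Let A = {u_k ⊗ v_k : k = 1, …, N} ⊂ ℂ^n ⊗ ℂ^m be an unextendable product set. Then there exists a real number λ > 0 such that for every vector y ∈ ℂ^m, the operator (1_{ℂ^n} ⊗ y)* ( Σ_{k=1}^{N} u_k u_k* ⊗ v_k v_k* ) (1_{ℂ^n} ⊗ y) − λ‖y‖² 1_{ℂ^n} is positive semidefinite. -/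
open Matrix Complex
open scoped Matrix Kronecker ComplexOrder

noncomputable section

lemma tens_dot_s13 {α β : Type*} [Fintype α] [Fintype β] (a x : α → ℂ) (b y : β → ℂ) :
    star (tens a b) ⬝ᵥ tens x y = (star a ⬝ᵥ x) * (star b ⬝ᵥ y) := by
  simp only [dotProduct, tens, Pi.star_apply, Fintype.sum_prod_type, Finset.sum_mul_sum, star_mul']
  refine Finset.sum_congr rfl fun i _ => Finset.sum_congr rfl fun j _ => ?_
  ring

lemma star_dot_self {α : Type*} [Fintype α] (x : α → ℂ) :
    star x ⬝ᵥ x = ((∑ i, ‖x i‖ ^ 2 : ℝ) : ℂ) := by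
  simp only [dotProduct, Pi.star_apply, Complex.ofReal_sum]
  refine Finset.sum_congr rfl fun i _ => ?_
  simpa using Complex.conj_mul' (x i)

lemma lower_bound (n m N : ℕ)
    (u : Fin N → Fin n → ℂ) (v : Fin N → Fin m → ℂ)
    (hups : ∀ (x : Fin n → ℂ) (y : Fin m → ℂ),
      (∀ k, (star (u k) ⬝ᵥ x) * (star (v k) ⬝ᵥ y) = 0) → x = 0 ∨ y = 0) :
    ∃ lam : ℝ, 0 < lam ∧ ∀ (x : EuclideanSpace ℂ (Fin n)) (y : EuclideanSpace ℂ (Fin m)),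
      lam * ‖x‖ ^ 2 * ‖y‖ ^ 2 ≤
        ∑ k, ‖star (u k) ⬝ᵥ x.ofLp‖ ^ 2 * ‖star (v k) ⬝ᵥ y.ofLp‖ ^ 2 := by
  let f : EuclideanSpace ℂ (Fin n) × EuclideanSpace ℂ (Fin m) → ℝ := fun p =>
    ∑ k, ‖star (u k) ⬝ᵥ p.1.ofLp‖ ^ 2 * ‖star (v k) ⬝ᵥ p.2.ofLp‖ ^ 2
  have hf : Continuous f := by
    simp only [f, dotProduct]
    fun_prop
  have hK : IsCompact (Metric.sphere (0 : EuclideanSpace ℂ (Fin n)) 1 ×ˢ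
      Metric.sphere (0 : EuclideanSpace ℂ (Fin m)) 1) :=
    (isCompact_sphere _ _).prod (isCompact_sphere _ _)
  have hpos : ∀ p ∈ (Metric.sphere (0 : EuclideanSpace ℂ (Fin n)) 1 ×ˢ
      Metric.sphere (0 : EuclideanSpace ℂ (Fin m)) 1), 0 < f p := by
    rintro ⟨x, y⟩ ⟨hx, hy⟩
    have hx1 : ‖x‖ = 1 := by simpa using hx
    have hy1 : ‖y‖ = 1 := by simpa using hy
    have hnn : 0 ≤ f (x, y) := Finset.sum_nonneg fun k _ => by positivity
    refine lt_of_le_of_ne hnn fun h => ?_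
    have h2 := (Finset.sum_eq_zero_iff_of_nonneg (fun k _ => by positivity)).1 h.symm
    rcases hups x.ofLp y.ofLp (fun k => by
      have := h2 k (Finset.mem_univ _)
      simpa using this) with h0 | h0
    · have : x = 0 := by ext i; simp [h0]
      simp [this] at hx1
    · have : y = 0 := by ext i; simp [h0]
      simp [this] at hy1
  obtain ⟨lam, hl, hle⟩ := hK.exists_forall_le' hf.continuousOn hpos
  refine ⟨lam, hl, fun x y => ?_⟩
  by_cases hx : x = 0
  · subst hx; simp
  by_cases hy : y = 0
  · subst hy; simp
  have hx' : 0 < ‖x‖ := norm_pos_iff.2 hx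
  have hy' : 0 < ‖y‖ := norm_pos_iff.2 hy
  have h := hle (((‖x‖⁻¹ : ℝ) : ℂ) • x, ((‖y‖⁻¹ : ℝ) : ℂ) • y) (by
    constructor <;> simp [norm_smul, hx, hy])
  have e : f (((‖x‖⁻¹ : ℝ) : ℂ) • x, ((‖y‖⁻¹ : ℝ) : ℂ) • y) = (‖x‖⁻¹) ^ 2 * (‖y‖⁻¹) ^ 2 * f (x, y) := by
    simp only [f, Finset.mul_sum, WithLp.ofLp_smul, dotProduct_smul, norm_smul, Complex.norm_real,
      norm_inv, norm_norm]
    refine Finset.sum_congr rfl fun k _ => ?_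
    ring
  rw [e] at h
  change _ ≤ f (x, y)
  calc lam * ‖x‖ ^ 2 * ‖y‖ ^ 2 ≤ ((‖x‖⁻¹) ^ 2 * (‖y‖⁻¹) ^ 2 * f (x, y)) * ‖x‖ ^ 2 * ‖y‖ ^ 2 := by gcongr
    _ = f (x, y) := by field_simp

lemma compress_eq {α β : Type*} [Fintype α] [Fintype β] {N : ℕ} (u : Fin N → α → ℂ)
    (v : Fin N → β → ℂ) (y : β → ℂ) :
    blockCompress (∑ k, proj (u k) ⊗ₖ proj (v k)) y =
      ∑ k, ((‖star (v k) ⬝ᵥ y‖ ^ 2 : ℝ) : ℂ) • proj (u k) := by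
  ext i j
  have key : ∀ k, ((‖star (v k) ⬝ᵥ y‖ ^ 2 : ℝ) : ℂ) = ∑ a, ∑ b, star (y a) * v k a * (star (v k b) * y b) := by
    intro k
    rw [← Finset.sum_mul_sum, Complex.ofReal_pow, ← Complex.conj_mul']
    simp [dotProduct, mul_comm]
  simp only [blockCompress, Matrix.of_apply, Matrix.sum_apply, Matrix.smul_apply, smul_eq_mul, key,
    Finset.sum_mul, Finset.mul_sum, kroneckerMap_apply, proj, vecMulVec_apply, Pi.star_apply]
  conv_rhs => rw [Finset.sum_comm]
  refine Finset.sum_congr rfl fun a _ => ?_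
  conv_rhs => rw [Finset.sum_comm]
  refine Finset.sum_congr rfl fun b _ => ?_
  refine Finset.sum_congr rfl fun k _ => ?_
  ring

/-- Terhal's lemma: for any unextendable product set `{u_k ⊗ v_k}` there is `λ > 0` such that
`(1 ⊗ y)* (Σ_k u_k u_k* ⊗ v_k v_k*) (1 ⊗ y) − λ‖y‖²·1` is positive semidefinite for every
`y`. -/
theorem terhal_lemma (n m N : ℕ)
    (u : Fin N → Fin n → ℂ) (v : Fin N → Fin m → ℂ)
    (horth : ∀ k l, star (tens (u k) (v k)) ⬝ᵥ tens (u l) (v l) = if k = l then 1 else 0)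
    (hups : ∀ (x : Fin n → ℂ) (y : Fin m → ℂ),
      (∀ k, star (tens (u k) (v k)) ⬝ᵥ tens x y = 0) → x = 0 ∨ y = 0) :
    ∃ lam : ℝ, 0 < lam ∧ ∀ y : Fin m → ℂ,
      (blockCompress (∑ k, proj (u k) ⊗ₖ proj (v k)) y
        - ((lam : ℂ) * (star y ⬝ᵥ y)) • (1 : Matrix (Fin n) (Fin n) ℂ)).PosSemidef := by
  obtain ⟨lam, hl, hb⟩ := lower_bound n m N u v (fun x y h => hups x y fun k => by
    rw [tens_dot_s13]; exact h k)
  refine ⟨lam, hl, fun y => ?_⟩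
  rw [compress_eq, star_dot_self]
  refine Matrix.PosSemidef.of_dotProduct_mulVec_nonneg ?_ fun x => ?_
  · refine Matrix.IsHermitian.sub ?_ ?_
    · rw [Matrix.IsHermitian, Matrix.conjTranspose_sum]
      refine Finset.sum_congr rfl fun k _ => ?_
      rw [Matrix.conjTranspose_smul, proj, Matrix.conjTranspose_vecMulVec]
      simp
    · rw [Matrix.IsHermitian, Matrix.conjTranspose_smul]
      simp
  · have e1 : ∀ k, star x ⬝ᵥ (proj (u k) *ᵥ x) = ((‖star (u k) ⬝ᵥ x‖ ^ 2 : ℝ) : ℂ) := by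
      intro k
      have : star x ⬝ᵥ u k = star (star (u k) ⬝ᵥ x) := by
        rw [Matrix.star_dotProduct, dotProduct_comm]
      rw [proj, Matrix.vecMulVec_mulVec]
      simp only [op_smul_eq_smul, dotProduct_smul, smul_eq_mul, this]
      rw [Complex.ofReal_pow, ← Complex.mul_conj']
      rfl
    have h := hb (WithLp.toLp 2 x) (WithLp.toLp 2 y)
    rw [EuclideanSpace.norm_sq_eq, EuclideanSpace.norm_sq_eq] at h
    simp only [sub_mulVec, sum_mulVec, smul_mulVec, one_mulVec, dotProduct_sub, dotProduct_sum,
      dotProduct_smul, e1, star_dot_self, smul_eq_mul]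
    rw [← Complex.ofReal_mul, ← Complex.ofReal_mul]
    simp only [← Complex.ofReal_mul]
    rw [← Complex.ofReal_sum, ← Complex.ofReal_sub]
    refine Complex.zero_le_real.2 (sub_nonneg.2 ?_)
    refine le_trans (le_of_eq ?_) (h.trans (le_of_eq ?_))
    · ring
    · exact Finset.sum_congr rfl fun k _ => mul_comm _ _
end
end

section
/- Let X = Y = ℂ^n and let U, V be n×n unitary matrices such that V^T U is skew-symmetric, i.e. (V^T U)^T = −V^T U. Then the Hermitian operator 1_X ⊗ 1_Y − vec(U) vec(U)* − T_X( vec(V) vec(V)* ) on X ⊗ Y is block positive with respect to X : Y; in fact, for every unit vector y ∈ Y, the operator (1_X ⊗ y)* (1_X ⊗ 1_Y − vec(U)vec(U)* − T_X(vec(V)vec(V)*)) (1_X ⊗ y) = 1_X − U ȳ y^T U* − V̄ y y* V^T is an orthogonal projection and hence positive semidefinite. -/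
open Matrix Complex
open scoped Matrix Kronecker ComplexOrder

noncomputable section

/-- The vectorization `vec(U)` of a matrix, determined by `vec(|k⟩⟨j|) = |k⟩|j⟩`. -/
def vecM {n : ℕ} (U : Matrix (Fin n) (Fin n) ℂ) : Fin n × Fin n → ℂ := fun p => U p.1 p.2

theorem bh_formula {n : ℕ} (U V : Matrix (Fin n) (Fin n) ℂ) (y : Fin n → ℂ) :
    blockCompress ((1 : Matrix (Fin n × Fin n) (Fin n × Fin n) ℂ)
            - proj (vecM U) - ptFst (proj (vecM V))) y
      = (star y ⬝ᵥ y) • (1 : Matrix (Fin n) (Fin n) ℂ)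
        - proj (U *ᵥ star y) - proj ((V.map star) *ᵥ y) := by
  ext i j
  have h1 : ∑ a, ∑ b, star (y a) * (1 : Matrix (Fin n × Fin n) (Fin n × Fin n) ℂ) (i, a) (j, b) * y b
      = (star y ⬝ᵥ y) * (1 : Matrix (Fin n) (Fin n) ℂ) i j := by
    by_cases hij : i = j
    · subst hij
      simp [Matrix.one_apply, dotProduct]
    · simp [Matrix.one_apply, hij]
  have h2 : ∑ a, ∑ b, star (y a) * (U i a * star (U j b)) * y b
      = (U *ᵥ star y) i * star ((U *ᵥ star y) j) := by
    simp only [mulVec, dotProduct, star_sum, Finset.sum_mul_sum, star_mul', Pi.star_apply, star_star]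
    refine Finset.sum_congr rfl fun a _ => Finset.sum_congr rfl fun b _ => ?_
    ring
  have h3 : ∑ a, ∑ b, star (y a) * (V j a * star (V i b)) * y b
      = ((V.map star) *ᵥ y) i * star (((V.map star) *ᵥ y) j) := by
    simp only [mulVec, dotProduct, star_sum, Finset.sum_mul_sum, star_mul', Matrix.map_apply, star_star]
    rw [Finset.sum_comm]
    refine Finset.sum_congr rfl fun a _ => Finset.sum_congr rfl fun b _ => ?_
    ring
  simp only [blockCompress, Matrix.of_apply, Matrix.sub_apply, Matrix.smul_apply, smul_eq_mul, proj,
    ptFst, vecMulVec_apply, vecM, Pi.star_apply, mul_sub, sub_mul, Finset.sum_sub_distrib]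
  rw [h1, h2, h3]

theorem bh_proj_herm {n : ℕ} (u : Fin n → ℂ) : (proj u)ᴴ = proj u := by
  ext i j
  simp [proj, vecMulVec_apply, mul_comm]

theorem bh_proj_mul {n : ℕ} (u w : Fin n → ℂ) :
    proj u * proj w = (star u ⬝ᵥ w) • vecMulVec u (star w) := by
  simp [proj, vecMulVec_mul_vecMulVec]

theorem bh_core {n : ℕ} (U V : Matrix (Fin n) (Fin n) ℂ)
    (hU : U ∈ Matrix.unitaryGroup (Fin n) ℂ) (hV : V ∈ Matrix.unitaryGroup (Fin n) ℂ)
    (hskew : (Vᵀ * U)ᵀ = -(Vᵀ * U)) (y : Fin n → ℂ) (P : Matrix (Fin n) (Fin n) ℂ)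
    (hP : P = (star y ⬝ᵥ y) • (1 : Matrix (Fin n) (Fin n) ℂ)
        - proj (U *ᵥ star y) - proj ((V.map star) *ᵥ y)) :
    P.IsHermitian ∧ P * P = (star y ⬝ᵥ y) • P ∧ P.PosSemidef := by
  have hU' : Uᴴ * U = 1 := Matrix.mem_unitaryGroup_iff'.mp hU
  have hV' : Vᴴ * V = 1 := Matrix.mem_unitaryGroup_iff'.mp hV
  have hVm : (V.map star)ᴴ = Vᵀ := by ext i j; simp
  have hVm' : Vᵀ * V.map star = 1 := by
    have := congrArg Matrix.transpose hV'
    rw [Matrix.transpose_mul, Matrix.transpose_one] at this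
    exact this
  have huu : star (U *ᵥ star y) ⬝ᵥ (U *ᵥ star y) = star y ⬝ᵥ y := by
    rw [star_mulVec, ← dotProduct_mulVec, mulVec_mulVec, hU', one_mulVec, star_star, dotProduct_comm]
  have hww : star ((V.map star) *ᵥ y) ⬝ᵥ ((V.map star) *ᵥ y) = star y ⬝ᵥ y := by
    rw [star_mulVec, ← dotProduct_mulVec, mulVec_mulVec, hVm, hVm', one_mulVec]
  have hwu : star ((V.map star) *ᵥ y) ⬝ᵥ (U *ᵥ star y) = 0 := by
    rw [star_mulVec, ← dotProduct_mulVec, mulVec_mulVec, hVm]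
    have h : star y ⬝ᵥ ((Vᵀ * U) *ᵥ star y) = -(star y ⬝ᵥ ((Vᵀ * U) *ᵥ star y)) := by
      conv_lhs => rw [dotProduct_mulVec, ← mulVec_transpose, hskew, neg_mulVec, neg_dotProduct,
        dotProduct_comm]
    exact self_eq_neg.mp h
  have huw : star (U *ᵥ star y) ⬝ᵥ ((V.map star) *ᵥ y) = 0 := by
    rw [star_dotProduct, hwu, star_zero]
  have hs : star (star y ⬝ᵥ y) = star y ⬝ᵥ y := (star_dotProduct y y).symm
  have hs0 : 0 ≤ star y ⬝ᵥ y := dotProduct_star_self_nonneg y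
  generalize U *ᵥ star y = u at *
  generalize V.map star *ᵥ y = w at *
  have hH : Pᴴ = P := by
    rw [hP]
    simp only [conjTranspose_sub, conjTranspose_smul, conjTranspose_one, bh_proj_herm, hs]
  have hsq : P * P = (star y ⬝ᵥ y) • P := by
    have e1 := bh_proj_mul u u
    have e2 := bh_proj_mul w w
    have e3 := bh_proj_mul u w
    have e4 := bh_proj_mul w u
    rw [huu] at e1
    rw [hww] at e2
    rw [huw, zero_smul] at e3
    rw [hwu, zero_smul] at e4
    change _ = _ • proj u at e1
    change _ = _ • proj w at e2
    rw [hP]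
    simp only [sub_mul, mul_sub, e1, e2, e3, e4, smul_mul_assoc, mul_smul_comm, one_mul, mul_one,
      smul_sub]
    abel
  refine ⟨hH, hsq, ?_⟩
  by_cases h0 : star y ⬝ᵥ y = 0
  · have hu : u = 0 := dotProduct_star_self_eq_zero.mp (by rw [huu, h0])
    have hw : w = 0 := dotProduct_star_self_eq_zero.mp (by rw [hww, h0])
    have : P = 0 := by rw [hP, h0, hu, hw]; simp [proj]
    rw [this]
    exact Matrix.PosSemidef.zero
  · have : P = (star y ⬝ᵥ y)⁻¹ • (Pᴴ * P) := by
      rw [hH, hsq, smul_smul, inv_mul_cancel₀ h0, one_smul]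
    rw [this]
    exact (Matrix.posSemidef_conjTranspose_mul_self P).smul (inv_nonneg.mpr hs0)

/-- Breuer–Hall: if `U, V` are unitary with `Vᵀ U` skew-symmetric, then
`1 ⊗ 1 − vec(U)vec(U)* − T_X(vec(V)vec(V)*)` is block positive; in fact, for every unit
vector `y`, `(1 ⊗ y)*(1 ⊗ 1 − vec(U)vec(U)* − T_X(vec(V)vec(V)*))(1 ⊗ y) =
1 − Uȳyᵀ U* − V̄ y y* Vᵀ` is an orthogonal projection, hence positive semidefinite. -/
theorem breuer_hall (n : ℕ) (U V : Matrix (Fin n) (Fin n) ℂ)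
    (hU : U ∈ Matrix.unitaryGroup (Fin n) ℂ) (hV : V ∈ Matrix.unitaryGroup (Fin n) ℂ)
    (hskew : (Vᵀ * U)ᵀ = -(Vᵀ * U)) :
    BlockPositive ((1 : Matrix (Fin n × Fin n) (Fin n × Fin n) ℂ)
        - proj (vecM U) - ptFst (proj (vecM V))) ∧
    ∀ y : Fin n → ℂ, star y ⬝ᵥ y = 1 →
      blockCompress ((1 : Matrix (Fin n × Fin n) (Fin n × Fin n) ℂ)
            - proj (vecM U) - ptFst (proj (vecM V))) y
          = 1 - proj (U *ᵥ star y) - proj ((V.map star) *ᵥ y) ∧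
      (blockCompress ((1 : Matrix (Fin n × Fin n) (Fin n × Fin n) ℂ)
            - proj (vecM U) - ptFst (proj (vecM V))) y).IsHermitian ∧
      blockCompress ((1 : Matrix (Fin n × Fin n) (Fin n × Fin n) ℂ)
            - proj (vecM U) - ptFst (proj (vecM V))) y *
          blockCompress ((1 : Matrix (Fin n × Fin n) (Fin n × Fin n) ℂ)
            - proj (vecM U) - ptFst (proj (vecM V))) y
          = blockCompress ((1 : Matrix (Fin n × Fin n) (Fin n × Fin n) ℂ)
            - proj (vecM U) - ptFst (proj (vecM V))) y ∧
      (blockCompress ((1 : Matrix (Fin n × Fin n) (Fin n × Fin n) ℂ)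
            - proj (vecM U) - ptFst (proj (vecM V))) y).PosSemidef := by
  refine ⟨fun y => (bh_core U V hU hV hskew y _ (bh_formula U V y)).2.2, fun y hy => ?_⟩
  obtain ⟨h1, h2, h3⟩ := bh_core U V hU hV hskew y _ (bh_formula U V y)
  refine ⟨?_, h1, ?_, h3⟩
  · rw [bh_formula, hy, one_smul]
  · rw [h2, hy, one_smul]
end
end
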